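/- Let m ≥ 1, suppose (α, {δ_i}_{i=0}^m) represents a minimal norm pair (a, d) of length m, and let X = X(α, {δ_i}, d, m) be the associated m-exceptional module. Then X is isomorphic to X_{a,d,m} as an R_m[G]-module, via an isomorphism induced by y ↦ [α]_m and x_i ↦ [δ_i]_m for 0 ≤ i < m; moreover, X is an indecomposable R_m[G]-module. -/

import Mathlib

/-!
Common setup.  Throughout, `K/F` is a cyclic Galois extension of degree `p^n`
with Galois group `G = Gal(K/F)` generated by `σ`.  For `0 ≤ i ≤ n`, `K_i`
denotes the intermediate field of degree `p^i` over `F`, realized here via its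
unit group `KiU p σ i` (the units of `K` fixed by `σ^{p^i}`), and
`G_i = Gal(K_i/F)`.  For `m ≥ 1`, `R_m = ℤ/p^m` and `J_m = K^×/K^{×p^m}`.
-/

namespace MSS

variable {F K : Type*} [Field F] [Field K] [Algebra F K]

/-- Action of a field automorphism on the unit group. -/
def umap (σ : K ≃ₐ[F] K) : Kˣ →* Kˣ := Units.map (σ : K →* K)

/-- The norm from `K_j` to `F`, computed in `K` as the product of conjugates
`∏_{k < p^j} σ^k(γ)` (valid for `γ ∈ K_j`). -/
noncomputable def normHom (p : ℕ) (σ : K ≃ₐ[F] K) (j : ℕ) : Kˣ →* Kˣ :=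
  ∏ k ∈ Finset.range (p ^ j), umap (σ ^ k)

/-- The unit group of the intermediate field `K_i`: the units fixed by `σ^{p^i}`. -/
def KiU (p : ℕ) (σ : K ≃ₐ[F] K) (i : ℕ) : Subgroup Kˣ :=
  (umap (σ ^ p ^ i) / MonoidHom.id Kˣ).ker

/-- Membership in `K_a^×` for a level `a ∈ {-∞, 0, 1, …}`; level `-∞` means
the trivial group `{1}`. -/
def levelMem (p : ℕ) (σ : K ≃ₐ[F] K) (a : WithBot ℕ) (γ : Kˣ) : Prop :=
  WithBot.recBotCoe (γ = 1) (fun i => γ ∈ KiU p σ i) a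

/-- `(α, δ)` represents the pair `(a, d)`:  `σ(α)·α^{-d} = ∏_{i=0}^m δ_i^{p^i}` with
`δ_i ∈ K_{a_i}^×` for `i < m`, and
`ξ_p = N_{K/F}(α)^{(d-1)/p} · N_{K_{n-1}/F}(δ_0) · ∏_{i=1}^m N_{K/F}(δ_i)^{p^{i-1}}`. -/
noncomputable def Represents (p n : ℕ) (σ : K ≃ₐ[F] K) (ξ : Kˣ) {m : ℕ}
    (a : Fin m → WithBot ℕ) (d : ℤ) (α : Kˣ) (δ : ℕ → Kˣ) : Prop :=
  (∀ i : Fin m, levelMem p σ (a i) (δ i)) ∧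
  umap σ α = α ^ d * ∏ i ∈ Finset.range (m + 1), δ i ^ p ^ i ∧
  ξ = normHom p σ n α ^ ((d - 1) / (p : ℤ)) * normHom p σ (n - 1) (δ 0) *
      ∏ i ∈ Finset.Icc 1 m, normHom p σ n (δ i) ^ p ^ (i - 1)

/-- `(a, d)` is a norm pair of length `m`: `a ∈ {-∞,0,…,n}^m` with `a_0 < n`,
`d ∈ U_1`, and some `(α, δ)` represents `(a, d)`. -/
noncomputable def IsNormPair (p n : ℕ) (σ : K ≃ₐ[F] K) (ξ : Kˣ) {m : ℕ}
    (a : Fin m → WithBot ℕ) (d : ℤ) : Prop :=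
  (∀ i, a i ≤ (n : WithBot ℕ)) ∧
  (∀ h0 : 0 < m, a ⟨0, h0⟩ < (n : WithBot ℕ)) ∧
  (p : ℤ) ∣ d - 1 ∧
  ∃ (α : Kˣ) (δ : ℕ → Kˣ), Represents p n σ ξ a d α δ

/-- Strict lexicographic order on norm vectors (with `-∞` smallest). -/
def vecLT {m : ℕ} (a a' : Fin m → WithBot ℕ) : Prop :=
  ∃ k : Fin m, (∀ j : Fin m, j < k → a j = a' j) ∧ a k < a' k

/-- The order `d ≤_m d'` on twists: `d' ∈ U_i → d ∈ U_i` for `1 ≤ i ≤ m`, except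
when `p = 2` and `d, d' ∉ U_2`, in which case `d' ∈ -U_i → d ∈ -U_i` for `2 ≤ i ≤ m`. -/
def twistLE (p m : ℕ) (d d' : ℤ) : Prop :=
  ((p = 2 ∧ ¬ (4 : ℤ) ∣ (d - 1) ∧ ¬ (4 : ℤ) ∣ (d' - 1)) →
    ∀ i : ℕ, 2 ≤ i → i ≤ m → ((2 : ℤ) ^ i ∣ (d' + 1)) → ((2 : ℤ) ^ i ∣ (d + 1))) ∧
  (¬ (p = 2 ∧ ¬ (4 : ℤ) ∣ (d - 1) ∧ ¬ (4 : ℤ) ∣ (d' - 1)) →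
    ∀ i : ℕ, 1 ≤ i → i ≤ m → ((p : ℤ) ^ i ∣ (d' - 1)) → ((p : ℤ) ^ i ∣ (d - 1)))

/-- The order `⪯_m` on norm pairs of length `m`. -/
def pairLE (p : ℕ) {m : ℕ} (a : Fin m → WithBot ℕ) (d : ℤ)
    (a' : Fin m → WithBot ℕ) (d' : ℤ) : Prop :=
  vecLT a a' ∨ (a = a' ∧ twistLE p m d d')

/-- `(a, d)` is a minimal norm pair of length `m`. -/
noncomputable def IsMinimalNormPair (p n : ℕ) (σ : K ≃ₐ[F] K) (ξ : Kˣ) {m : ℕ}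
    (a : Fin m → WithBot ℕ) (d : ℤ) : Prop :=
  IsNormPair p n σ ξ a d ∧
  ∀ (a' : Fin m → WithBot ℕ) (d' : ℤ), IsNormPair p n σ ξ a' d' → pairLE p a d a' d'

/-- `α` is an `m`-exceptional element. -/
noncomputable def IsExceptional (p n : ℕ) (σ : K ≃ₐ[F] K) (ξ : Kˣ) (m : ℕ) (α : Kˣ) : Prop :=
  ∃ (a : Fin m → WithBot ℕ) (d : ℤ) (δ : ℕ → Kˣ),
    IsMinimalNormPair p n σ ξ a d ∧ Represents p n σ ξ a d α δ

/-- The subgroup of `q`-th powers in `K^×`. -/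
def powSub (K : Type*) [Field K] (q : ℕ) : Subgroup Kˣ := (powMonoidHom q : Kˣ →* Kˣ).range

/-- The class of a unit in `J_q := K^×/K^{×q}`. -/
def jcls (q : ℕ) (γ : Kˣ) : Kˣ ⧸ powSub K q := QuotientGroup.mk γ

/-- The action of a field automorphism on `J_q = K^×/K^{×q}`. -/
noncomputable def jmap (q : ℕ) (τ : K ≃ₐ[F] K) : (Kˣ ⧸ powSub K q) →* Kˣ ⧸ powSub K q :=
  QuotientGroup.map _ _ (umap τ) (by
    rintro x ⟨y, rfl⟩
    exact ⟨umap τ y, by simp [powMonoidHom, map_pow]⟩)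

/-- The natural map `J_q → J_{q'}` when `q' ∣ q`. -/
noncomputable def resMap (q q' : ℕ) (h : q' ∣ q) : (Kˣ ⧸ powSub K q) →* Kˣ ⧸ powSub K q' :=
  QuotientGroup.map _ _ (MonoidHom.id Kˣ) (by
    rintro x ⟨y, rfl⟩
    obtain ⟨c, rfl⟩ := h
    exact ⟨y ^ c, by simp [powMonoidHom, ← pow_mul, mul_comm]⟩)

/-- The `R_m[G]`-submodule of `J_q` generated by the classes of the elements of `S`:
the subgroup generated by all `σ^k`-conjugates of classes of elements of `S`. -/
noncomputable def galSpan (q : ℕ) (σ : K ≃ₐ[F] K) (S : Set Kˣ) : Subgroup (Kˣ ⧸ powSub K q) :=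
  Subgroup.closure {x | ∃ γ ∈ S, ∃ k : ℕ, x = jcls q (umap (σ ^ k) γ)}

/-- The subgroup `(σ-1)J_q` of `J_q`. -/
noncomputable def augSub (q : ℕ) (σ : K ≃ₐ[F] K) : Subgroup (Kˣ ⧸ powSub K q) :=
  Subgroup.closure {x | ∃ y : Kˣ ⧸ powSub K q, x = jmap q σ y * y⁻¹}

/-- The cyclic `F_p[G]`-submodule of `J_1 = K^×/K^{×p}` generated by `[γ]_1` is a
free `F_p[G_i]`-module (on the generator `[γ]_1`): `[γ]_1` is fixed by `σ^{p^i}`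
and the conjugates `σ^k [γ]_1`, `k < p^i`, are `F_p`-linearly independent. -/
noncomputable def FreeCyc (p : ℕ) (σ : K ≃ₐ[F] K) (i : ℕ) (γ : Kˣ) : Prop :=
  jcls p (umap (σ ^ p ^ i) γ) = jcls p γ ∧
  ∀ c : Fin (p ^ i) → ZMod p,
    (∏ k : Fin (p ^ i), jcls p (umap (σ ^ (k : ℕ)) γ) ^ (c k).val) = 1 → c = 0

/-- An (indexed) internal direct sum decomposition of a commutative group. -/
def IsDirectSumDecomp {G : Type*} [CommGroup G] {ι : Sort*} (f : ι → Subgroup G) : Prop :=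
  iSupIndep f ∧ (⨆ i, f i) = ⊤

/-- The subgroup `F^×` of `K^×` (units coming from the base field). -/
def Funits (F : Type*) {K : Type*} [Field F] [Field K] [Algebra F K] : Subgroup Kˣ :=
  (Units.map (algebraMap F K : F →* K)).range

/-- The subgroup `F^{×p}` of `K^×`. -/
def FpPow (F : Type*) {K : Type*} [Field F] [Field K] [Algebra F K] (p : ℕ) : Subgroup Kˣ :=
  (Funits F).map (powMonoidHom p)

/-- The subgroup `N_{K_i/F}(K_i^×)` of `K^×`. -/
noncomputable def NormSub (p : ℕ) (σ : K ≃ₐ[F] K) (i : ℕ) : Subgroup Kˣ :=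
  (KiU p σ i).map (normHom p σ i)

/-- The subgroup `N_{K_i/F}(K_i^×)·F^{×p}` of `K^×`. -/
noncomputable def NiF (p : ℕ) (σ : K ≃ₐ[F] K) (i : ℕ) : Subgroup Kˣ :=
  NormSub p σ i ⊔ FpPow F p

/-- The `F_p`-dimension of an (elementary abelian `p`-) commutative group `Q`,
computed as the rank of `F_p ⊗_ℤ Q`. -/
noncomputable def fpdim (p : ℕ) (Q : Type*) [CommGroup Q] : Cardinal :=
  Module.rank (ZMod p) (TensorProduct ℤ (ZMod p) (Additive Q))

/-- The invariant `e_i(K/F)`: for `i < n` the `F_p`-dimension of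
`N_{K_i/F}(K_i^×)F^{×p} / N_{K_{i+1}/F}(K_{i+1}^×)F^{×p}`, and for `i = n` the
`F_p`-dimension of `N_{K/F}(K^×)F^{×p}/F^{×p}`. -/
noncomputable def eKF (p n : ℕ) (σ : K ≃ₐ[F] K) (i : ℕ) : Cardinal :=
  if i < n then
    fpdim p ((NiF p σ i) ⧸ (NiF p σ (i + 1)).subgroupOf (NiF p σ i))
  else
    fpdim p ((NiF p σ n) ⧸ (FpPow F p).subgroupOf (NiF p σ n))

/-- The group ring `R_m[G_i] = (ℤ/p^m)[ℤ/p^i]` (for the cyclic group `G_i` of order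
`p^i`). -/
abbrev CycGR (p m i : ℕ) : Type :=
  MonoidAlgebra (ZMod (p ^ m)) (Multiplicative (ZMod (p ^ i)))

/-- The image of the generator `σ` of `G_i` in the group ring `R_m[G_i]`. -/
noncomputable def gen (p m i : ℕ) : CycGR p m i :=
  MonoidAlgebra.of _ _ (Multiplicative.ofAdd (1 : ZMod (p ^ i)))

/-- Standard basis vector of the free `R_m[G]`-module on generators `e_0, …, e_m`. -/
noncomputable def sing (p n m : ℕ) (j : Fin (m + 1)) (c : CycGR p m n) :
    Fin (m + 1) → CycGR p m n :=
  Pi.single j c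

/-- The relations defining the module `X_{a,d,m}`: on generators `y = e_0` and
`x_i = e_{i+1}` (`0 ≤ i < m`), we impose `(σ - d)·y = Σ_i p^i x_i`, and
`(σ^{p^{a_i}} - 1)·x_i = 0` when `a_i ≠ -∞`, resp. `x_i = 0` when `a_i = -∞`. -/
noncomputable def XRels (p n m : ℕ) (a : Fin m → WithBot ℕ) (d : ℤ) :
    Set (Fin (m + 1) → CycGR p m n) :=
  insert
    (sing p n m 0 (gen p m n - (d : ZMod (p ^ m)) • 1) -
      ∑ i : Fin m, sing p n m i.succ ((p : CycGR p m n) ^ (i : ℕ)))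
    {r | ∃ i : Fin m, r = sing p n m i.succ
      (WithBot.recBotCoe (1 : CycGR p m n) (fun k => gen p m n ^ p ^ k - 1) (a i))}

/-- The `R_m[G]`-module `X_{a,d,m}`. -/
noncomputable abbrev Xadm (p n m : ℕ) (a : Fin m → WithBot ℕ) (d : ℤ) :=
  (Fin (m + 1) → CycGR p m n) ⧸ Submodule.span (CycGR p m n) (XRels p n m a d)

/-- Indecomposability of a module. -/
def IsIndecomposable (R M : Type*) [Ring R] [AddCommGroup M] [Module R M] : Prop :=
  (⊤ : Submodule R M) ≠ ⊥ ∧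
  ∀ S T : Submodule R M, S ⊓ T = ⊥ → S ⊔ T = ⊤ → S = ⊥ ∨ T = ⊥

end MSS

namespace MSS

variable {F K : Type*} [Field F] [Field K] [Algebra F K]

/-- A σ-stable subgroup `S` of `J_q` (i.e. an `R_m[G]`-submodule) is
indecomposable: `S ≠ ⊥`, and whenever `S` is the internal direct sum of two
σ-stable subgroups, one of them is trivial. -/
noncomputable def SubIndec (q : ℕ) (σ : K ≃ₐ[F] K)
    (S : Subgroup (Kˣ ⧸ powSub K q)) : Prop :=
  S ≠ ⊥ ∧
  ∀ S₁ S₂ : Subgroup (Kˣ ⧸ powSub K q), S₁ ≤ S → S₂ ≤ S →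
    (∀ x ∈ S₁, jmap q σ x ∈ S₁) → (∀ x ∈ S₂, jmap q σ x ∈ S₂) →
    S₁ ⊓ S₂ = ⊥ → S₁ ⊔ S₂ = S → S₁ = ⊥ ∨ S₂ = ⊥

/-- The set `X_m = {α, δ_1, …, δ_{m-1}} \ {1}`. -/
def XmSet (m : ℕ) (α : Kˣ) (δ : ℕ → Kˣ) : Set Kˣ :=
  ({α} ∪ δ '' Set.Icc 1 (m - 1)) \ {1}

end MSS

universe u v

namespace MSS

section CyclicKummerTheory

open Polynomial

/-- The trace polynomial `1 + X + ⋯ + X ^ (p ^ j - 1)`. -/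
noncomputable def trPoly (p j : ℕ) : ℤ[X] := ∑ k ∈ Finset.range (p ^ j), X ^ k

/-- The relative trace polynomial from level `s` to level `j`. -/
noncomputable def relPoly (p s j : ℕ) : ℤ[X] :=
  ∑ k ∈ Finset.range (p ^ (s - j)), (X ^ p ^ j) ^ k

/-- The annihilator polynomial of level `a`. -/
noncomputable def annPoly (p : ℕ) (a : WithBot ℕ) : ℤ[X] :=
  WithBot.recBotCoe (1 : ℤ[X]) (fun k => X ^ p ^ k - 1) a

@[simp] lemma annPoly_bot (p : ℕ) : annPoly p ⊥ = 1 := rfl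

@[simp] lemma annPoly_coe (p k : ℕ) : annPoly p (k : WithBot ℕ) = X ^ p ^ k - 1 := rfl

lemma annPoly_some (p k : ℕ) : annPoly p (WithBot.some k) = X ^ p ^ k - 1 := rfl

lemma trPoly_mul (p j : ℕ) : (X - 1) * trPoly p j = X ^ p ^ j - 1 := mul_geom_sum _ _

lemma relPoly_mul (p : ℕ) {s j : ℕ} (h : j ≤ s) :
    (X ^ p ^ j - 1) * relPoly p s j = X ^ p ^ s - 1 := by
  rw [relPoly, mul_geom_sum, ← pow_mul, ← pow_add, Nat.add_sub_cancel' h]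

lemma X_sub_one_ne_zero : (X - 1 : ℤ[X]) ≠ 0 := by
  simpa using X_sub_C_ne_zero (1 : ℤ)

lemma monic_X_pow_sub_one {p : ℕ} (hp : p.Prime) (k : ℕ) : (X ^ p ^ k - 1 : ℤ[X]).Monic := by
  simpa using monic_X_pow_sub_C (1 : ℤ) (pow_pos hp.pos k).ne'

lemma trPoly_mul_relPoly (p : ℕ) {s j : ℕ} (h : j ≤ s) :
    trPoly p j * relPoly p s j = trPoly p s := by
  apply mul_left_cancel₀ X_sub_one_ne_zero
  rw [← mul_assoc, trPoly_mul, relPoly_mul p h, trPoly_mul]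

lemma relPoly_mul_relPoly {p : ℕ} (hp : p.Prime) {s j k : ℕ} (h : j ≤ s) (h' : s ≤ k) :
    relPoly p s j * relPoly p k s = relPoly p k j := by
  apply mul_left_cancel₀ (monic_X_pow_sub_one hp j).ne_zero
  rw [← mul_assoc, relPoly_mul p h, relPoly_mul p h', relPoly_mul p (h.trans h')]

lemma exists_eq_eval_one (P : ℤ[X]) :
    ∃ Q : ℤ[X], P = ((P.eval 1 : ℤ) : ℤ[X]) + (X - 1) * Q := by
  have : (X - C (1 : ℤ)) ∣ P - C (P.eval 1) := by
    rw [dvd_iff_isRoot]; simp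
  obtain ⟨Q, hQ⟩ := this
  refine ⟨Q, ?_⟩
  have h : (C (P.eval 1) : ℤ[X]) = ((P.eval 1 : ℤ) : ℤ[X]) := by simp
  rw [← h]
  rw [C_1] at hQ
  linear_combination hQ

@[simp] lemma eval_one_trPoly (p j : ℕ) : (trPoly p j).eval 1 = (p : ℤ) ^ j := by
  simp [trPoly, eval_finsetSum]

@[simp] lemma eval_one_relPoly (p s j : ℕ) : (relPoly p s j).eval 1 = (p : ℤ) ^ (s - j) := by
  simp [relPoly, eval_finsetSum]

lemma exists_relPoly_eq (p s : ℕ) : ∃ Q : ℤ[X],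
    relPoly p (s + 1) s = (p : ℤ[X]) + (X ^ p ^ s - 1) * Q ∧ 2 * Q.eval 1 = (p : ℤ) * (p - 1) := by
  refine ⟨∑ l ∈ Finset.range p, ∑ k ∈ Finset.range l, (X ^ p ^ s) ^ k, ?_, ?_⟩
  · rw [relPoly, Finset.mul_sum]
    have : ∀ l, (X ^ p ^ s - 1 : ℤ[X]) * ∑ k ∈ Finset.range l, (X ^ p ^ s) ^ k
        = (X ^ p ^ s) ^ l - 1 := fun l => mul_geom_sum _ _
    simp only [this, Finset.sum_sub_distrib, Nat.add_sub_cancel_left, pow_one]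
    simp
  · have := Finset.sum_range_id_mul_two p
    simp only [eval_finsetSum, eval_pow, eval_X, one_pow, Finset.sum_const, Finset.card_range,
      nsmul_eq_mul, mul_one]
    rw [← Nat.cast_sum, mul_comm]
    rcases Nat.eq_zero_or_pos p with rfl | hp
    · simp
    · have h2 : ((p - 1 : ℕ) : ℤ) = p - 1 := by push_cast [hp]; ring
      rw [← h2]; exact_mod_cast this

variable {A : Type*} [AddCommGroup A] [Module ℤ[X] A]

lemma smul_fixed {f : A} (hf : ((X : ℤ[X]) - 1) • f = 0) (P : ℤ[X]) :
    P • f = ((P.eval 1 : ℤ) : ℤ[X]) • f := by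
  obtain ⟨Q, hQ⟩ := exists_eq_eval_one P
  linear_combination (norm := module) hQ • f + Q • hf

lemma trPoly_smul_fixed {p s : ℕ} {x : A} (hx : ((X : ℤ[X]) ^ p ^ s - 1) • x = 0) :
    ((X : ℤ[X]) - 1) • trPoly p s • x = 0 := by
  rw [← mul_smul, trPoly_mul, hx]

/-- The properties of the multiplicative group of a cyclic extension of degree `p ^ n`
used below: Hilbert 90 and the structure of the `p`-torsion. -/
structure CyclicKummer (p n : ℕ) (A : Type*) [AddCommGroup A] [Module ℤ[X] A] (ξ : A) :
    Prop where
  prime : p.Prime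
  pos : 0 < n
  ann : ∀ x : A, ((X : ℤ[X]) ^ p ^ n - 1) • x = 0
  hilbert : ∀ j ≤ n, ∀ x : A, relPoly p n j • x = 0 → ∃ y, x = ((X : ℤ[X]) ^ p ^ j - 1) • y
  ne_zero : ξ ≠ 0
  smul_eq_zero : (p : ℤ[X]) • ξ = 0
  fixed : ((X : ℤ[X]) - 1) • ξ = 0
  torsion : ∀ x : A, (p : ℤ[X]) • x = 0 → ∃ c : ℤ, x = (c : ℤ[X]) • ξ
  special : p = 2 → n = 1 → ∃ γ : A, trPoly p n • γ = ξ

namespace CyclicKummer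

variable {p n : ℕ} {ξ : A} (H : CyclicKummer p n A ξ)
include H

lemma hilbert_level {s j : ℕ} (hs : s ≤ n) (hj : j ≤ s) {x : A} (hx : relPoly p s j • x = 0) :
    ∃ y, ((X : ℤ[X]) ^ p ^ s - 1) • y = 0 ∧ x = ((X : ℤ[X]) ^ p ^ j - 1) • y := by
  obtain ⟨y, hy⟩ := H.hilbert j (hj.trans hs) x (by
    rw [← relPoly_mul_relPoly H.prime hj hs, mul_comm, mul_smul, hx, smul_zero])
  refine ⟨y, ?_, hy⟩
  rw [← relPoly_mul p hj, mul_comm, mul_smul, ← hy, hx]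

/-- A fixed element `x` killed by `p`, at a level below the top, is a coboundary. -/
lemma exists_sub_one_smul {j : ℕ} (hj : j < n) {x : A} (hp : (p : ℤ[X]) • x = 0) :
    ∃ y, x = ((X : ℤ[X]) ^ p ^ j - 1) • y := by
  obtain ⟨c, rfl⟩ := H.torsion x hp
  apply H.hilbert j hj.le
  have h1 : ((X : ℤ[X]) - 1) • (c : ℤ[X]) • ξ = 0 := by rw [smul_comm, H.fixed, smul_zero]
  rw [smul_fixed h1, eval_one_relPoly]
  obtain ⟨k, hk⟩ : ∃ k, n - j = k + 1 := ⟨n - j - 1, by omega⟩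
  rw [hk, pow_succ]
  push_cast
  rw [mul_smul, hp, smul_zero]

lemma int_dvd {c : ℤ} {x : A} (hx : x ≠ 0) (hpx : (p : ℤ[X]) • x = 0)
    (h : (c : ℤ[X]) • x = 0) : (p : ℤ) ∣ c := by
  by_contra hc
  obtain ⟨u, v, huv⟩ : IsCoprime (p : ℤ) c :=
    ((Nat.prime_iff_prime_int.mp H.prime).coprime_iff_not_dvd).2 hc
  apply hx
  have h2 := congrArg (Int.cast : ℤ → ℤ[X]) huv
  push_cast at h2
  linear_combination (norm := module) -(h2 • x) + (u : ℤ[X]) • hpx + (v : ℤ[X]) • h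

lemma of_torsion {x : A} (hx : x ≠ 0) (hpx : (p : ℤ[X]) • x = 0) : CyclicKummer p n A x := by
  obtain ⟨c, hc⟩ := H.torsion x hpx
  have hcp : ¬ (p : ℤ) ∣ c := by
    rintro ⟨k, rfl⟩
    apply hx
    rw [hc]; push_cast
    rw [mul_comm, mul_smul, H.smul_eq_zero, smul_zero]
  obtain ⟨u, v, huv⟩ : IsCoprime (p : ℤ) c :=
    ((Nat.prime_iff_prime_int.mp H.prime).coprime_iff_not_dvd).2 hcp
  have h2 := congrArg (Int.cast : ℤ → ℤ[X]) huv
  push_cast at h2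
  have hξ : ξ = (v : ℤ[X]) • x := by
    rw [hc]
    linear_combination (norm := module) -(h2 • ξ) + (u : ℤ[X]) • H.smul_eq_zero
  refine ⟨H.prime, H.pos, H.ann, H.hilbert, hx, hpx, ?_, ?_, ?_⟩
  · rw [hc, smul_comm, H.fixed, smul_zero]
  · intro y hy
    obtain ⟨w, hw⟩ := H.torsion y hy
    refine ⟨w * v, ?_⟩
    rw [hw]; conv_lhs => rw [hξ]
    push_cast; rw [mul_smul]
  · intro h2 h1
    obtain ⟨γ, hγ⟩ := H.special h2 h1
    refine ⟨(c : ℤ[X]) • γ, ?_⟩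
    rw [smul_comm, hγ, hc]

end CyclicKummer

end CyclicKummerTheory

section MinimalVectorsTheory

open Polynomial

variable {A : Type*} [AddCommGroup A] [Module ℤ[X] A]

lemma annPoly_dvd_annPoly {p : ℕ} {a b : WithBot ℕ} (h : a ≤ b) :
    annPoly p a ∣ annPoly p b := by
  induction a using WithBot.recBotCoe with
  | bot => simp
  | coe s =>
    induction b using WithBot.recBotCoe with
    | bot => simp at h
    | coe t =>
      have h' : s ≤ t := by exact_mod_cast h
      exact ⟨relPoly p t s, (relPoly_mul p h').symm⟩

lemma annPoly_smul_of_le {p : ℕ} {a b : WithBot ℕ} (h : a ≤ b) {x : A}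
    (hx : annPoly p a • x = 0) : annPoly p b • x = 0 := by
  obtain ⟨Q, hQ⟩ := annPoly_dvd_annPoly (p := p) h
  rw [hQ, mul_comm, mul_smul, hx, smul_zero]

lemma trPoly_succ_smul {p s : ℕ} {x : A} (hx : ((X : ℤ[X]) ^ p ^ s - 1) • x = 0) :
    trPoly p (s + 1) • x = (p : ℤ[X]) • trPoly p s • x := by
  obtain ⟨Q, hQ, -⟩ := exists_relPoly_eq p s
  have h := trPoly_mul_relPoly p s.le_succ
  rw [hQ] at h
  linear_combination (norm := module) -(h • x) + (trPoly p s * Q) • hx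

lemma trPoly_smul_level {p s t : ℕ} (h : s ≤ t) {x : A}
    (hx : ((X : ℤ[X]) ^ p ^ s - 1) • x = 0) :
    trPoly p t • x = (p : ℤ[X]) ^ (t - s) • trPoly p s • x := by
  rw [← trPoly_mul_relPoly p h, mul_comm, mul_smul, smul_fixed (trPoly_smul_fixed hx),
    eval_one_relPoly]
  push_cast; rfl

lemma trPoly_zero (p : ℕ) : trPoly p 0 = 1 := by simp [trPoly]

lemma relPoly_zero (p n : ℕ) : relPoly p n 0 = trPoly p n := by
  rw [← trPoly_mul_relPoly p (Nat.zero_le n), trPoly_zero, one_mul]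

/-- The polynomial giving the contribution of `δ i` to the norm condition. -/
noncomputable def normPoly (p n i : ℕ) : ℤ[X] :=
  if i = 0 then trPoly p (n - 1) else (p : ℤ[X]) ^ (i - 1) * trPoly p n

@[simp] lemma normPoly_zero (p n : ℕ) : normPoly p n 0 = trPoly p (n - 1) := rfl

@[simp] lemma normPoly_succ (p n i : ℕ) :
    normPoly p n (i + 1) = (p : ℤ[X]) ^ i * trPoly p n := rfl

/-- `(α, δ)` satisfies the equation of a norm pair with vector `a` and twist `1 + p * e`, with
norm value `lam`. -/
structure IsRep (p n m : ℕ) (a : ℕ → WithBot ℕ) (e : ℤ) (α : A) (δ : ℕ → A) (lam : A) :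
    Prop where
  level : ∀ i < m, annPoly p (a i) • δ i = 0
  eq : ((X : ℤ[X]) - (1 + (p : ℤ[X]) * (e : ℤ[X]))) • α =
    ∑ i ∈ Finset.range (m + 1), (p : ℤ[X]) ^ i • δ i
  norm : (e : ℤ[X]) • trPoly p n • α + ∑ i ∈ Finset.range (m + 1), normPoly p n i • δ i = lam

/-- The norm vector `a` is lexicographically minimal. -/
structure IsMinVec (p n m : ℕ) (A : Type*) [AddCommGroup A] [Module ℤ[X] A]
    (a : ℕ → WithBot ℕ) : Prop where
  pos : 0 < m
  le : ∀ i < m, a i ≤ n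
  lt : a 0 < n
  min : ∀ k < m, ∀ a' : ℕ → WithBot ℕ, (∀ i < m, a' i ≤ n) → a' 0 < n →
    (∀ j < k, a' j = a j) → a' k < a k →
    ∀ (e : ℤ) (α : A) (δ : ℕ → A) (lam : A), IsRep p n m a' e α δ lam → lam = 0

lemma sum_range_split {M : Type*} [AddCommMonoid M] (f : ℕ → M) {k m : ℕ} (h : k ≤ m) :
    ∑ i ∈ Finset.range (m + 1), f i =
      ∑ i ∈ Finset.range k, f i + f k + ∑ j ∈ Finset.range (m - k), f (k + 1 + j) := by
  rw [show m + 1 = (k + 1) + (m - k) by omega, Finset.sum_range_add, Finset.sum_range_succ]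

/-- The combination of the terms of index above `k`. -/
noncomputable def upperSum (p m : ℕ) (δ : ℕ → A) (k : ℕ) : A :=
  ∑ j ∈ Finset.range (m - k), (p : ℤ[X]) ^ j • δ (k + 1 + j)

lemma sum_pow_split (p : ℕ) {k m : ℕ} (h : k ≤ m) (δ : ℕ → A) :
    ∑ i ∈ Finset.range (m + 1), (p : ℤ[X]) ^ i • δ i =
      ∑ i ∈ Finset.range k, (p : ℤ[X]) ^ i • δ i + (p : ℤ[X]) ^ k • δ k +
        (p : ℤ[X]) ^ (k + 1) • upperSum p m δ k := by
  rw [sum_range_split _ h, upperSum, Finset.smul_sum]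
  congr 1
  exact Finset.sum_congr rfl fun j _ => by rw [← mul_smul, ← pow_add]

lemma sum_normPoly_split (p n : ℕ) {k m : ℕ} (h : k ≤ m) (δ : ℕ → A) :
    ∑ i ∈ Finset.range (m + 1), normPoly p n i • δ i =
      ∑ i ∈ Finset.range k, normPoly p n i • δ i + normPoly p n k • δ k +
        (p : ℤ[X]) ^ k • trPoly p n • upperSum p m δ k := by
  rw [sum_range_split _ h, upperSum, Finset.smul_sum, Finset.smul_sum]
  congr 1
  refine Finset.sum_congr rfl fun j _ => ?_
  rw [show k + 1 + j = (k + j) + 1 by ring, normPoly_succ, pow_add]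
  module

namespace IsMinVec

variable {p n m : ℕ} {a : ℕ → WithBot ℕ} (hM : IsMinVec p n m A a)
include hM

lemma coe_le {k s : ℕ} (hk : k < m) (h : a k = s) : s ≤ n := by
  have := hM.le k hk
  rw [h] at this
  exact_mod_cast this

lemma coe_lt {s : ℕ} (h : a 0 = s) : s < n := by
  have := hM.lt
  rw [h] at this
  exact_mod_cast this

lemma norm_eq_zero (hann : ∀ x : A, ((X : ℤ[X]) ^ p ^ n - 1) • x = 0)
    {k : ℕ} (hk : k < m) {b : WithBot ℕ} (hb : b < a k) (e : ℤ) (α : A)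
    (δ : ℕ → A) (ε η : A) (hδ : ∀ i < k, annPoly p (a i) • δ i = 0) (hε : annPoly p b • ε = 0)
    (h : ((X : ℤ[X]) - (1 + (p : ℤ[X]) * (e : ℤ[X]))) • α =
      ∑ i ∈ Finset.range k, (p : ℤ[X]) ^ i • δ i + (p : ℤ[X]) ^ k • ε +
        (p : ℤ[X]) ^ (k + 1) • η) :
    (e : ℤ[X]) • trPoly p n • α + (∑ i ∈ Finset.range k, normPoly p n i • δ i +
      normPoly p n k • ε + (p : ℤ[X]) ^ k • trPoly p n • η) = 0 := by
  set δ' : ℕ → A := fun i => if i < k then δ i else if i = k then ε else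
    if i = k + 1 then η else 0 with hδ'
  have hlt : ∀ i < k, δ' i = δ i := fun i hi => by simp [hδ', hi]
  have hkk : δ' k = ε := by simp [hδ']
  have hupperSum : upperSum p m δ' k = η := by
    rw [upperSum, Finset.sum_eq_single_of_mem 0 (by simpa using hk)]
    · simp [hδ']
    · intro j _ hj
      simp only [hδ']
      rw [if_neg (by omega), if_neg (by omega), if_neg (by omega), smul_zero]
  have hsum : ∀ f : ℕ → ℤ[X], ∑ i ∈ Finset.range k, f i • δ' i =
      ∑ i ∈ Finset.range k, f i • δ i := fun f =>
    Finset.sum_congr rfl fun i hi => by rw [hlt i (Finset.mem_range.1 hi)]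
  refine hM.min k hk (fun i => if i < k then a i else if i = k then b else n) ?_ ?_ ?_ ?_
    e α δ' _ ⟨?_, ?_, ?_⟩
  · intro i hi
    split_ifs with h1 h2
    · exact hM.le i hi
    · exact hb.le.trans (hM.le k hk)
    · exact le_rfl
  · split_ifs with h1 h2
    · exact hM.lt
    · subst h2; exact hb.trans hM.lt
    · omega
  · intro j hj; simp [hj]
  · simpa using hb
  · intro i hi
    split_ifs with h1 h2
    · rw [hlt i h1]; exact hδ i h1
    · rw [h2, hkk]; exact hε
    · exact hann _
  · rw [h, sum_pow_split p hk.le, hkk, hupperSum, hsum]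
  · rw [sum_normPoly_split p n hk.le, hkk, hupperSum, hsum]

end IsMinVec

/-- A solution of the norm pair equations for a minimal vector, with norm value `ξ`. -/
structure MinRep (p n m : ℕ) (a : ℕ → WithBot ℕ) (e : ℤ) (α : A) (δ : ℕ → A) (ξ : A) :
    Prop where
  kummer : CyclicKummer p n A ξ
  vec : IsMinVec p n m A a
  rep : IsRep p n m a e α δ ξ

lemma dvd_pow_mul_of_two_mul {p n : ℕ} (hp : p.Prime) (hn : 0 < n) (h : ¬ (p = 2 ∧ n = 1))
    {c : ℤ} (hc : 2 * c = (p : ℤ) * (p - 1)) : (p : ℤ) ∣ p ^ (n - 1) * c := by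
  by_cases h1 : n = 1
  · have hp2 : p ≠ 2 := fun h2 => h ⟨h2, h1⟩
    have hpz := Nat.prime_iff_prime_int.mp hp
    have h2 : (p : ℤ) ∣ 2 * c := ⟨_, hc⟩
    rcases hpz.dvd_or_dvd h2 with h3 | h3
    · have : p ∣ 2 := by exact_mod_cast h3
      exact absurd ((Nat.prime_dvd_prime_iff_eq hp Nat.prime_two).1 this) hp2
    · exact h3.mul_left _
  · exact (dvd_pow_self _ (by omega)).mul_right _

namespace CyclicKummer

variable {p n : ℕ} {ξ : A} (H : CyclicKummer p n A ξ)
include H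

lemma trPoly_pred_smul (hpn : ¬ (p = 2 ∧ n = 1)) {x : A}
    (hx : ((X : ℤ[X]) ^ p ^ (n - 1) - 1) • (p : ℤ[X]) • x = 0) :
    trPoly p (n - 1) • (p : ℤ[X]) • x = trPoly p n • x := by
  obtain ⟨k, rfl⟩ : ∃ k, n = k + 1 := ⟨n - 1, by have := H.pos; omega⟩
  rw [Nat.add_sub_cancel] at hx ⊢
  obtain ⟨Q, hQ, hQ1⟩ := exists_relPoly_eq p k
  have hT := trPoly_mul_relPoly p k.le_succ
  rw [hQ] at hT
  set z := ((X : ℤ[X]) ^ p ^ k - 1) • x with hz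
  have hpz : (p : ℤ[X]) • z = 0 := by rw [hz, smul_comm, hx]
  have hzf : ((X : ℤ[X]) - 1) • z = 0 := by
    obtain ⟨c, hc⟩ := H.torsion z hpz
    rw [hc, smul_comm, H.fixed, smul_zero]
  have h1 : (trPoly p k * Q) • z = 0 := by
    rw [smul_fixed hzf]
    obtain ⟨w, hw⟩ := dvd_pow_mul_of_two_mul H.prime H.pos hpn hQ1
    rw [Nat.add_sub_cancel] at hw
    rw [eval_mul, eval_one_trPoly, hw]
    push_cast
    rw [mul_comm, mul_smul, hpz, smul_zero]
  linear_combination (norm := module) hT • x - h1 + (trPoly p k * Q) • hz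

lemma exists_descent {s : ℕ} (hs : s + 1 ≤ n) {x f : A}
    (hf : ((X : ℤ[X]) - 1) • f = 0) (h : trPoly p (s + 1) • x = (p : ℤ[X]) • f) :
    ∃ x' ν : A, ((X : ℤ[X]) ^ p ^ s - 1) • x' = 0 ∧ ((X : ℤ[X]) ^ p ^ (s + 1) - 1) • ν = 0 ∧
      x = x' + ((X : ℤ[X]) - 1) • ν := by
  have hr : relPoly p (s + 1) s • f = (p : ℤ[X]) • f := by
    rw [smul_fixed hf]; simp
  have hT := trPoly_mul_relPoly p s.le_succ
  obtain ⟨ν, hν, hxν⟩ := H.hilbert_level hs s.le_succ (x := trPoly p s • x - f) (by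
    linear_combination (norm := module) hT • x + h - hr)
  have hX := trPoly_mul p s
  refine ⟨x - ((X : ℤ[X]) - 1) • ν, ν, ?_, hν, by abel⟩
  linear_combination (norm := module) ((X : ℤ[X]) - 1) • hxν - hX • x
    + ((X : ℤ[X]) - 1) • hX • ν + hf - ((X : ℤ[X]) - 1) • hX • ν

lemma exists_descent_of_lt {s : ℕ} (hs : s < n) {x κ : A}
    (hx : ((X : ℤ[X]) ^ p ^ s - 1) • x = 0) (h : trPoly p s • x = (p : ℤ[X]) • κ) :
    ∃ (b : WithBot ℕ) (x' ν η : A), b < s ∧ annPoly p b • x' = 0 ∧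
      ((X : ℤ[X]) ^ p ^ s - 1) • ν = 0 ∧ ((X : ℤ[X]) ^ p ^ s - 1) • (p : ℤ[X]) • η = 0 ∧
      x = x' + ((X : ℤ[X]) - 1) • ν + (p : ℤ[X]) • η := by
  rcases s with _ | s
  · rw [trPoly_zero, one_smul] at h
    exact ⟨⊥, 0, 0, κ, WithBot.bot_lt_coe _, by simp, by simp, by rw [← h, hx], by simp [h]⟩
  · have hfix := trPoly_smul_fixed hx
    rw [h, smul_comm] at hfix
    obtain ⟨ζ, hζ⟩ := H.exists_sub_one_smul hs hfix
    have hX := trPoly_mul p (s + 1)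
    have hpζ : ((X : ℤ[X]) ^ p ^ (s + 1) - 1) • (p : ℤ[X]) • ζ = 0 := by
      rw [smul_comm, ← hζ, hfix]
    obtain ⟨x', ν, hx', hν, hxν⟩ := H.exists_descent hs.le (x := x - (p : ℤ[X]) • ζ)
      (f := κ - trPoly p (s + 1) • ζ)
      (by linear_combination (norm := module) hζ - hX • ζ)
      (by linear_combination (norm := module) h)
    refine ⟨s, x', ν, ζ, by exact_mod_cast s.lt_succ_self, hx', hν, hpζ, ?_⟩
    rw [← hxν]; abel

end CyclicKummer

namespace MinRep

variable {p n m : ℕ} {a : ℕ → WithBot ℕ} {e : ℤ} {α : A} {δ : ℕ → A} {ξ : A}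
  (h : MinRep p n m a e α δ ξ)
include h

lemma eq_split {k : ℕ} (hk : k < m) : ((X : ℤ[X]) - (1 + (p : ℤ[X]) * (e : ℤ[X]))) • α =
    ∑ i ∈ Finset.range k, (p : ℤ[X]) ^ i • δ i + (p : ℤ[X]) ^ k • δ k +
      (p : ℤ[X]) ^ (k + 1) • upperSum p m δ k := by
  rw [h.rep.eq, sum_pow_split p hk.le]

lemma norm_split {k : ℕ} (hk : k < m) : (e : ℤ[X]) • trPoly p n • α +
    (∑ i ∈ Finset.range k, normPoly p n i • δ i + normPoly p n k • δ k +
      (p : ℤ[X]) ^ k • trPoly p n • upperSum p m δ k) = ξ := by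
  rw [← sum_normPoly_split p n hk.le, h.rep.norm]

lemma trPoly_X_sub_one (x : A) : trPoly p n • ((X : ℤ[X]) - 1) • x = 0 := by
  rw [← mul_smul, mul_comm, trPoly_mul, h.kummer.ann]

lemma level_coe {k s : ℕ} (hk : k < m) (hs : a k = s) :
    ((X : ℤ[X]) ^ p ^ s - 1) • δ k = 0 := by
  have := h.rep.level k hk
  rwa [hs] at this

lemma eq_zero_of_bot {k : ℕ} (hk : k < m) (hs : a k = ⊥) : δ k = 0 := by
  have := h.rep.level k hk
  rwa [hs, annPoly_bot, one_smul] at this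

/-- The finite entries of a minimal norm vector strictly increase. -/
lemma coe_lt_coe {k j s t : ℕ} (hkj : k < j) (hj : j < m) (hs : a k = s) (ht : a j = t) :
    s < t := by
  by_contra! hts
  obtain ⟨i, rfl⟩ : ∃ i, j = k + 1 + i := ⟨j - k - 1, by omega⟩
  set z := (p : ℤ[X]) ^ (i + 1) • δ (k + 1 + i) with hz
  set δ' : ℕ → A := fun j => δ j + if j = k then z else 0 with hδ'
  have hsum : ∀ f : ℕ → ℤ[X], ∑ j ∈ Finset.range (k + 1 + i), f j • δ' j =
      ∑ j ∈ Finset.range (k + 1 + i), f j • δ j + f k • z := by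
    intro f
    simp only [hδ', smul_add, Finset.sum_add_distrib]
    congr 1
    rw [Finset.sum_eq_single_of_mem k (by simp; omega)]
    · simp
    · intro b _ hb; simp [hb]
  have hlev : ((X : ℤ[X]) ^ p ^ s - 1) • δ (k + 1 + i) = 0 := by
    have := annPoly_smul_of_le (show (t : WithBot ℕ) ≤ s by exact_mod_cast hts)
      (h.level_coe hj ht)
    exact this
  have h1 := h.eq_split hj
  have h2 := h.norm_split hj
  have hL : normPoly p n k • z = normPoly p n (k + 1 + i) • δ (k + 1 + i) := by
    rcases k with _ | k
    · have hsn := h.vec.coe_lt hs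
      have h3 := trPoly_succ_smul (p := p) (s := n - 1) (x := δ (0 + 1 + i))
        (annPoly_smul_of_le (show (s : WithBot ℕ) ≤ (n - 1 : ℕ) by
          exact_mod_cast Nat.le_sub_one_of_lt hsn) hlev)
      rw [Nat.sub_add_cancel h.kummer.pos] at h3
      rw [hz]
      simp only [Nat.zero_add, Nat.add_comm 1 i, normPoly_succ, normPoly_zero, mul_smul] at h3 ⊢
      rw [h3]; module
    · rw [hz, show k + 1 + 1 + i = (k + 1 + i) + 1 by ring, normPoly_succ, normPoly_succ]
      module
  have h3 := h.vec.norm_eq_zero h.kummer.ann hj (b := ⊥) (by rw [ht]; exact WithBot.bot_lt_coe _)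
    e α δ' 0 (upperSum p m δ (k + 1 + i)) ?_ (by simp) ?_
  · apply h.kummer.ne_zero
    rw [hsum] at h3
    rw [← h2, ← h3]
    linear_combination (norm := module) -hL
  · intro j hj'
    simp only [hδ']
    split_ifs with hjk
    · rw [hjk, hs, annPoly_coe, smul_add, h.level_coe (by omega) hs, hz, smul_comm, hlev]
      simp
    · rw [add_zero]; exact h.rep.level j (by omega)
  · rw [h1, hsum, hz]
    module

/-- In the exceptional case `p = 2`, `n = 1`, the first entry of the norm vector is `-∞`. -/
lemma eq_bot (h2 : p = 2) (h1 : n = 1) : a 0 = ⊥ := by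
  by_contra hne
  obtain ⟨γ, hγ⟩ := h.kummer.special h2 h1
  obtain ⟨y, hy⟩ := h.kummer.hilbert 0 (Nat.zero_le _) ((p : ℤ[X]) • γ) (by
    rw [relPoly_zero, smul_comm, hγ, h.kummer.smul_eq_zero])
  have := h.vec.norm_eq_zero h.kummer.ann h.vec.pos (b := ⊥) (bot_lt_iff_ne_bot.2 hne)
    0 y δ 0 γ (by simp) (by simp) (by simpa using hy.symm)
  apply h.kummer.ne_zero
  simpa [hγ] using this

lemma not_replace_zero {b : WithBot ℕ} (hb : b < a 0) {x ν η : A} (hx : annPoly p b • x = 0)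
    (hδ : δ 0 = x + ((X : ℤ[X]) - 1) • ν + (p : ℤ[X]) • η)
    (hnorm : trPoly p (n - 1) • δ 0 = trPoly p (n - 1) • x + trPoly p n • η) : False := by
  have h1 := h.eq_split h.vec.pos
  have h2 := h.norm_split h.vec.pos
  have hν := h.trPoly_X_sub_one ν
  have h3 := h.vec.norm_eq_zero h.kummer.ann h.vec.pos hb e (α - ν) δ x
    (η + upperSum p m δ 0 + (e : ℤ[X]) • ν) (by simp) hx (by
      simp only [Finset.range_zero, Finset.sum_empty] at h1 ⊢
      linear_combination (norm := module) h1 + hδ)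
  apply h.kummer.ne_zero
  simp only [Finset.range_zero, Finset.sum_empty, normPoly_zero] at h2 h3
  linear_combination (norm := module) h3 - h2 + hnorm

lemma not_replace_succ {k : ℕ} (hk : k + 1 < m) {b : WithBot ℕ} (hb : b < a (k + 1))
    {x ν η : A} {c : ℤ} (hx : annPoly p b • x = 0)
    (hδ : δ (k + 1) = x + ((X : ℤ[X]) - 1) • ν + (p : ℤ[X]) • η + (c : ℤ[X]) • α) : False := by
  have h1 := h.eq_split hk
  have h2 := h.norm_split hk
  have hν := h.trPoly_X_sub_one ν
  have h3 := h.vec.norm_eq_zero h.kummer.ann hk hb (e + c * p ^ k) (α - (p : ℤ[X]) ^ (k + 1) • ν)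
    δ x (η + upperSum p m δ (k + 1) + ((e + c * p ^ k : ℤ) : ℤ[X]) • ν)
    (fun i hi => h.rep.level i (by omega)) hx (by
      push_cast
      linear_combination (norm := module) h1 + (p : ℤ[X]) ^ (k + 1) • hδ)
  apply h.kummer.ne_zero
  simp only [normPoly_succ] at h2 h3
  push_cast at h3
  linear_combination (norm := module) h3 - h2 + ((p : ℤ[X]) ^ k * trPoly p n) • hδ
    + (p : ℤ[X]) ^ k • hν

/-- Descent from the top level. -/
lemma exists_descent_top {x κ : A} (hx : trPoly p n • x = (p : ℤ[X]) • κ) :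
    ∃ (c : ℤ) (x' ν : A), ((X : ℤ[X]) ^ p ^ (n - 1) - 1) • x' = 0 ∧
      x = x' + ((X : ℤ[X]) - 1) • ν + (c : ℤ[X]) • α := by
  obtain ⟨k, hk⟩ : ∃ k, n = k + 1 := ⟨n - 1, by have := h.kummer.pos; omega⟩
  subst hk
  rw [Nat.add_sub_cancel]
  have h1 := h.eq_split h.vec.pos
  have h2 := h.norm_split h.vec.pos
  simp only [Finset.range_zero, Finset.sum_empty, normPoly_zero, Nat.add_sub_cancel] at h1 h2
  obtain ⟨Q, hQ, hQ1⟩ := exists_relPoly_eq p k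
  have hT := trPoly_mul_relPoly p (Nat.le_add_right k 1)
  rw [hQ] at hT
  have hX := trPoly_mul p k
  set ψ := (e : ℤ[X]) • α + upperSum p m δ 0 with hψ
  set κ' := trPoly p k • (α + (Q * trPoly p k) • ψ) with hκ'
  have hκ1 : ((X : ℤ[X]) - 1) • κ' = ξ := by
    rw [← h2, hκ']
    linear_combination (norm := module) trPoly p k • h1 - ((p : ℤ[X]) * trPoly p k) • hψ
      + trPoly p (k + 1) • hψ + hX • (Q * trPoly p k) • ψ + hT • ψ
  have hα : ((X : ℤ[X]) - 1) • α = δ 0 + (p : ℤ[X]) • ψ := by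
    linear_combination (norm := module) h1 - (p : ℤ[X]) • hψ
  obtain ⟨g, hg, hκg⟩ : ∃ g : A, ((X : ℤ[X]) - 1) • g = 0 ∧
      (p : ℤ[X]) • κ' = trPoly p (k + 1) • α + (p : ℤ[X]) • g := by
    have key : (p : ℤ[X]) • κ' = trPoly p (k + 1) • α
        - (trPoly p k * Q) • trPoly p k • δ 0 := by
      rw [hκ']
      linear_combination (norm := module) hT • α + hX • (trPoly p k * Q) • α
        - (trPoly p k * Q * trPoly p k) • hα
    have h0 : ((X : ℤ[X]) ^ p ^ k - 1) • δ 0 = 0 :=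
      annPoly_smul_of_le (b := (k : WithBot ℕ)) (by
        have := h.vec.lt
        induction h0 : a 0 using WithBot.recBotCoe with
        | bot => simp
        | coe s => exact WithBot.coe_le_coe.2 (Nat.lt_succ_iff.1 (h.vec.coe_lt h0)))
        (h.rep.level 0 h.vec.pos)
    rw [smul_fixed (trPoly_smul_fixed h0)] at key
    by_cases hpn : p = 2 ∧ k + 1 = 1
    · refine ⟨0, smul_zero _, ?_⟩
      rw [key, h.eq_zero_of_bot h.vec.pos (h.eq_bot hpn.1 hpn.2)]
      simp
    · obtain ⟨w, hw⟩ := dvd_pow_mul_of_two_mul h.kummer.prime h.kummer.pos hpn hQ1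
      rw [Nat.add_sub_cancel] at hw
      rw [eval_mul, eval_one_trPoly, hw] at key
      push_cast at key
      refine ⟨-((w : ℤ[X]) • trPoly p k • δ 0), ?_, ?_⟩
      · rw [smul_neg, smul_comm, trPoly_smul_fixed h0, smul_zero, neg_zero]
      · linear_combination (norm := module) key
  have hp0 : (p : ℤ[X]) • ((X : ℤ[X]) - 1) • κ = 0 := by
    rw [smul_comm, ← hx, trPoly_smul_fixed (h.kummer.ann x)]
  obtain ⟨c, hc⟩ := h.kummer.torsion _ hp0
  obtain ⟨x', ν, hx', -, hxν⟩ := h.kummer.exists_descent le_rfl (x := x - (c : ℤ[X]) • α)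
    (f := κ - (c : ℤ[X]) • (κ' - g))
    (by linear_combination (norm := module) hc - (c : ℤ[X]) • hκ1 + (c : ℤ[X]) • hg)
    (by linear_combination (norm := module) hx + (c : ℤ[X]) • hκg)
  exact ⟨c, x', ν, hx', by rw [← hxν]; abel⟩

/-- Each `δ t` above level `s` yields an element of level `s` with the same trace. -/
lemma exists_lower {k j s : ℕ} (hkj : k < j) (hj : j < m) (hs : a k = s) :
    ∃ D v w : A, ((X : ℤ[X]) ^ p ^ s - 1) • D = 0 ∧
      trPoly p s • D = (WithBot.recBotCoe 0 (trPoly p) (a j) : ℤ[X]) • δ j ∧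
      D = ((X : ℤ[X]) - 1) • v + (p : ℤ[X]) • w ∧
      trPoly p (n - 1) • D = trPoly p n • w := by
  induction ht : a j using WithBot.recBotCoe with
  | bot => exact ⟨0, 0, 0, by simp⟩
  | coe t =>
    have hst := h.coe_lt_coe hkj hj hs ht
    have htn := h.vec.coe_le hj ht
    have hlev := h.level_coe hj ht
    have hfix := trPoly_smul_fixed hlev
    have hT := trPoly_mul_relPoly p hst.le
    have hD : ((X : ℤ[X]) ^ p ^ s - 1) • relPoly p t s • δ j = 0 := by
      rw [← mul_smul, relPoly_mul p hst.le, hlev]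
    have hTD : trPoly p s • relPoly p t s • δ j = trPoly p t • δ j := by rw [← mul_smul, hT]
    obtain ⟨Q, hQ⟩ := exists_eq_eval_one (relPoly p t s)
    rw [eval_one_relPoly, show t - s = (t - s - 1) + 1 by omega, pow_succ] at hQ
    push_cast at hQ
    refine ⟨relPoly p t s • δ j, Q • δ j, (p : ℤ[X]) ^ (t - s - 1) • δ j, hD, hTD, ?_, ?_⟩
    · linear_combination (norm := module) hQ • δ j
    · rw [trPoly_smul_level (show s ≤ n - 1 by omega) hD, hTD, smul_comm (trPoly p n),
        trPoly_smul_level htn hlev, ← mul_smul (_ ^ _) (_ ^ _), ← pow_add,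
        show t - s - 1 + (n - t) = n - 1 - s by omega]

/-- No nontrivial combination of the traces of the `δ j` is a `p`-th multiple. -/
lemma not_trace_mem {k s : ℕ} (hk : k < m) (hs : a k = s) (c : ℕ → ℤ) {κ : A}
    (hκ : trPoly p s • δ k + ∑ i ∈ Finset.range (m - (k + 1)), (c (k + 1 + i) : ℤ[X]) •
      (WithBot.recBotCoe 0 (trPoly p) (a (k + 1 + i)) : ℤ[X]) • δ (k + 1 + i) =
        (p : ℤ[X]) • κ) : False := by
  have hex : ∀ j, ∃ D v w : A, (k < j → j < m → ((X : ℤ[X]) ^ p ^ s - 1) • D = 0 ∧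
      trPoly p s • D = (WithBot.recBotCoe 0 (trPoly p) (a j) : ℤ[X]) • δ j ∧
      D = ((X : ℤ[X]) - 1) • v + (p : ℤ[X]) • w ∧
      trPoly p (n - 1) • D = trPoly p n • w) := by
    intro j
    by_cases hj : k < j ∧ j < m
    · obtain ⟨D, v, w, hD⟩ := h.exists_lower hj.1 hj.2 hs
      exact ⟨D, v, w, fun _ _ => hD⟩
    · exact ⟨0, 0, 0, fun h1 h2 => absurd ⟨h1, h2⟩ hj⟩
  choose D v w hDvw using hex
  have hin : ∀ i ∈ Finset.range (m - (k + 1)), k < k + 1 + i ∧ k + 1 + i < m := by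
    intro i hi; rw [Finset.mem_range] at hi; omega
  let S : (ℕ → A) → A := fun u => ∑ i ∈ Finset.range (m - (k + 1)),
    (c (k + 1 + i) : ℤ[X]) • u (k + 1 + i)
  have hS : ∀ (P : ℤ[X]) (u : ℕ → A), P • S u = S fun j => P • u j := by
    intro P u
    simp only [S, Finset.smul_sum]
    exact Finset.sum_congr rfl fun i _ => smul_comm _ _ _
  have hScongr : ∀ u u' : ℕ → A, (∀ j, k < j → j < m → u j = u' j) → S u = S u' := by
    intro u u' hu
    refine Finset.sum_congr rfl fun i hi => ?_
    rw [hu _ (hin i hi).1 (hin i hi).2]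
  have hSadd : ∀ u u' : ℕ → A, S (fun j => u j + u' j) = S u + S u' := by
    intro u u'
    simp [S, smul_add, Finset.sum_add_distrib]
  have hS0 : S (fun _ => 0) = 0 := by simp [S]
  have hlev : ((X : ℤ[X]) ^ p ^ s - 1) • (δ k + S D) = 0 := by
    rw [smul_add, h.level_coe hk hs, hS, hScongr _ (fun _ => 0)
      (fun j h1 h2 => (hDvw j h1 h2).1), hS0, add_zero]
  have htr : trPoly p s • (δ k + S D) = (p : ℤ[X]) • κ := by
    rw [smul_add, hS, hScongr _ _ (fun j h1 h2 => (hDvw j h1 h2).2.1), ← hκ]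
  have hdec : S D = ((X : ℤ[X]) - 1) • S v + (p : ℤ[X]) • S w := by
    rw [hS, hS]
    refine Eq.trans ?_ (hSadd (fun j => ((X : ℤ[X]) - 1) • v j) fun j => (p : ℤ[X]) • w j)
    exact hScongr _ _ (fun j h1 h2 => (hDvw j h1 h2).2.2.1)
  have hnorm : trPoly p (n - 1) • S D = trPoly p n • S w := by
    rw [hS, hS]
    exact hScongr _ _ (fun j h1 h2 => (hDvw j h1 h2).2.2.2)
  rcases k with _ | k
  · have hsn := h.vec.coe_lt hs
    have hpn : ¬ (p = 2 ∧ n = 1) := fun hpn => by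
      rw [h.eq_bot hpn.1 hpn.2] at hs; exact absurd hs WithBot.bot_ne_coe
    obtain ⟨b, x, ν, η, hb, hx, hν, hη, hD⟩ := h.kummer.exists_descent_of_lt hsn hlev htr
    have hsn' : (s : WithBot ℕ) ≤ ((n - 1 : ℕ) : WithBot ℕ) := by
      exact_mod_cast Nat.le_sub_one_of_lt hsn
    have hη' := h.kummer.trPoly_pred_smul hpn (annPoly_smul_of_le hsn' hη)
    have hν' : trPoly p (n - 1) • ((X : ℤ[X]) - 1) • ν = 0 := by
      rw [← mul_smul, mul_comm, trPoly_mul]; exact annPoly_smul_of_le hsn' hν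
    refine h.not_replace_zero (by rwa [hs]) hx (ν := ν - S v) (η := η - S w) ?_ ?_
    · linear_combination (norm := module) hD - hdec
    · linear_combination (norm := module) trPoly p (n - 1) • hD - hnorm + hη' + hν'
  · obtain ⟨b, x, ν, η, c', hb, hx, hD⟩ : ∃ (b : WithBot ℕ) (x ν η : A) (c' : ℤ), b < s ∧
        annPoly p b • x = 0 ∧ δ (k + 1) + S D =
          x + ((X : ℤ[X]) - 1) • ν + (p : ℤ[X]) • η + (c' : ℤ[X]) • α := by
      rcases (h.vec.coe_le hk hs).lt_or_eq with hsn | rfl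
      · obtain ⟨b, x, ν, η, hb, hx, -, -, hD⟩ := h.kummer.exists_descent_of_lt hsn hlev htr
        exact ⟨b, x, ν, η, 0, hb, hx, by simp [hD]⟩
      · obtain ⟨c', x, ν, hx, hD⟩ := h.exists_descent_top htr
        refine ⟨((s - 1 : ℕ) : WithBot ℕ), x, ν, 0, c', ?_, hx, by simp [hD]⟩
        have := h.kummer.pos
        exact_mod_cast Nat.sub_lt this one_pos
    refine h.not_replace_succ hk (by rwa [hs]) hx (ν := ν - S v) (η := η - S w) (c := c') ?_
    linear_combination (norm := module) hD - hdec

end MinRep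

end MinimalVectorsTheory

section RelationsTheory

open Polynomial

variable {A : Type*} [AddCommGroup A] [Module ℤ[X] A]

/-- The submodule of `q`-th multiples. -/
noncomputable def mulSub (A : Type*) [AddCommGroup A] [Module ℤ[X] A] (q : ℤ[X]) :
    Submodule ℤ[X] A :=
  LinearMap.range (LinearMap.lsmul ℤ[X] A q)

lemma mem_mulSub {q : ℤ[X]} {x : A} : x ∈ mulSub A q ↔ ∃ κ : A, x = q • κ := by
  simp only [mulSub, LinearMap.mem_range, LinearMap.lsmul_apply, eq_comm]

lemma smul_mem_mulSub (q : ℤ[X]) (x : A) : q • x ∈ mulSub A q := mem_mulSub.2 ⟨x, rfl⟩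

lemma smul_mem_mulSub_of_dvd {q r : ℤ[X]} (h : q ∣ r) (x : A) : r • x ∈ mulSub A q := by
  obtain ⟨w, rfl⟩ := h
  rw [mul_smul]
  exact smul_mem_mulSub _ _

/-- The trace polynomial of level `a`, zero at level `-∞`. -/
noncomputable def trBot (p : ℕ) (a : WithBot ℕ) : ℤ[X] :=
  WithBot.recBotCoe (0 : ℤ[X]) (trPoly p) a

@[simp] lemma trBot_bot (p : ℕ) : trBot p ⊥ = 0 := rfl

lemma trBot_some (p s : ℕ) : trBot p (WithBot.some s) = trPoly p s := rfl

/-- The ideal generated by `p` and the annihilator polynomial of level `a`. -/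
noncomputable def levelIdeal (p : ℕ) (a : WithBot ℕ) : Ideal ℤ[X] :=
  Ideal.span {annPoly p a, (p : ℤ[X])}

lemma mem_levelIdeal {p : ℕ} {a : WithBot ℕ} {g : ℤ[X]} :
    g ∈ levelIdeal p a ↔ ∃ B W : ℤ[X], g = annPoly p a * B + (p : ℤ[X]) * W := by
  rw [levelIdeal, Ideal.mem_span_pair]
  simp only [mul_comm _ (annPoly p a), mul_comm _ (p : ℤ[X]), eq_comm]

lemma p_mul_mem_levelIdeal (p : ℕ) (a : WithBot ℕ) (W : ℤ[X]) :
    (p : ℤ[X]) * W ∈ levelIdeal p a := mem_levelIdeal.2 ⟨0, W, by ring⟩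

lemma exists_sub_trBot_mem {p : ℕ} (hp : p.Prime) (a : WithBot ℕ) {h : ℤ[X]}
    (hh : (X - 1) * h ∈ levelIdeal p a) :
    ∃ c : ℤ, h - (c : ℤ[X]) * trBot p a ∈ levelIdeal p a := by
  induction a using WithBot.recBotCoe with
  | bot => exact ⟨0, mem_levelIdeal.2 ⟨h, 0, by simp⟩⟩
  | coe s =>
    obtain ⟨B, W, hBW⟩ := mem_levelIdeal.1 hh
    rw [annPoly_some, ← trPoly_mul] at hBW
    have h1 := congrArg (eval 1) hBW
    simp only [eval_mul, eval_sub, eval_X, eval_one, sub_self, zero_mul, eval_add, zero_add,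
      eval_natCast] at h1
    have h2 : W.eval 1 = 0 :=
      (mul_eq_zero.1 h1.symm).resolve_left (by exact_mod_cast hp.ne_zero)
    obtain ⟨W', hW'⟩ := exists_eq_eval_one W
    rw [h2, Int.cast_zero, zero_add] at hW'
    obtain ⟨B', hB'⟩ := exists_eq_eval_one B
    have h3 : h = trPoly p s * B + p * W' := by
      apply mul_left_cancel₀ X_sub_one_ne_zero
      rw [hBW, hW']; ring
    refine ⟨B.eval 1, mem_levelIdeal.2 ⟨B', W', ?_⟩⟩
    rw [trBot_some, annPoly_some, ← trPoly_mul]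
    linear_combination h3 + trPoly p s * hB'

lemma sub_one_pow_mul_mem {p : ℕ} (hp : p.Prime) {n : ℕ} {a : WithBot ℕ} (ha : a ≤ n)
    (g : ℤ[X]) : (X - 1) ^ p ^ n * g ∈ levelIdeal p a := by
  obtain ⟨r, hr⟩ := exists_add_pow_prime_pow_eq hp (X - 1 : ℤ[X]) 1 n
  obtain ⟨Q, hQ⟩ := annPoly_dvd_annPoly (p := p) ha
  rw [annPoly_coe] at hQ
  refine mem_levelIdeal.2 ⟨Q * g, -((X - 1) * 1 * r) * g, ?_⟩
  rw [sub_add_cancel, one_pow] at hr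
  linear_combination g * hQ - g * hr

lemma exists_p_mul_normPoly {p n : ℕ} (hn : 0 < n) {a : ℕ → WithBot ℕ} (ha : a 0 < n) (i : ℕ) :
    ∃ B : ℤ[X],
      (p : ℤ[X]) * normPoly p n i = (p : ℤ[X]) ^ i * trPoly p n + annPoly p (a i) * B := by
  rcases i with _ | i
  · obtain ⟨k, rfl⟩ : ∃ k, n = k + 1 := ⟨n - 1, by omega⟩
    obtain ⟨Q, hQ, -⟩ := exists_relPoly_eq p k
    have hT := trPoly_mul_relPoly p (Nat.le_add_right k 1)
    obtain ⟨P, hP⟩ : annPoly p (a 0) ∣ annPoly p (k : WithBot ℕ) :=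
      annPoly_dvd_annPoly (by
        induction h0 : a 0 using WithBot.recBotCoe with
        | bot => simp
        | coe s =>
          rw [h0] at ha
          exact WithBot.coe_le_coe.2 (Nat.lt_succ_iff.1 (WithBot.coe_lt_coe.1 ha)))
    rw [annPoly_coe] at hP
    refine ⟨-P * Q * trPoly p k, ?_⟩
    rw [normPoly_zero, Nat.add_sub_cancel]
    linear_combination hT - trPoly p k * hQ - Q * trPoly p k * hP
  · exact ⟨0, by rw [normPoly_succ]; ring⟩

namespace MinRep

variable {p n m : ℕ} {a : ℕ → WithBot ℕ} {e : ℤ} {α : A} {δ : ℕ → A} {ξ : A}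
  (h : MinRep p n m a e α δ ξ)
include h

lemma dvd_of_trace_mem (c : ℕ → ℤ)
    (hc : ∑ i ∈ Finset.range m, (c i : ℤ[X]) • trBot p (a i) • δ i ∈ mulSub A (p : ℤ[X])) :
    ∀ k < m, a k ≠ ⊥ → (p : ℤ) ∣ c k := by
  intro k
  induction k using Nat.strong_induction_on with
  | _ k ih =>
  intro hk hbot
  obtain ⟨s, hs⟩ := WithBot.ne_bot_iff_exists.1 hbot
  by_contra hck
  have hlow : ∑ i ∈ Finset.range k, (c i : ℤ[X]) • trBot p (a i) • δ i ∈ mulSub A (p : ℤ[X]) := by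
    refine Submodule.sum_mem _ fun i hi => ?_
    rw [Finset.mem_range] at hi
    by_cases hb : a i = ⊥
    · simp [hb]
    · refine smul_mem_mulSub_of_dvd ?_ _
      obtain ⟨w, hw⟩ := ih i hi (hi.trans hk) hb
      rw [hw]; push_cast; exact dvd_mul_right _ _
  rw [show m = k + 1 + (m - (k + 1)) by omega, Finset.sum_range_add, Finset.sum_range_succ,
    add_assoc, Submodule.add_mem_iff_right _ hlow] at hc
  obtain ⟨κ, hκ⟩ := mem_mulSub.1 hc
  obtain ⟨u, v, huv⟩ : IsCoprime (p : ℤ) (c k) :=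
    ((Nat.prime_iff_prime_int.mp h.kummer.prime).coprime_iff_not_dvd).2 hck
  have h2 := congrArg (Int.cast : ℤ → ℤ[X]) huv
  push_cast at h2
  refine h.not_trace_mem hk hs.symm (fun i => v * c i)
    (κ := (v : ℤ[X]) • κ + (u : ℤ[X]) • trPoly p s • δ k) ?_
  have h3 : ∑ i ∈ Finset.range (m - (k + 1)), ((v * c (k + 1 + i) : ℤ) : ℤ[X]) •
      trBot p (a (k + 1 + i)) • δ (k + 1 + i) =
      (v : ℤ[X]) • ∑ i ∈ Finset.range (m - (k + 1)), (c (k + 1 + i) : ℤ[X]) •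
      trBot p (a (k + 1 + i)) • δ (k + 1 + i) := by
    rw [Finset.smul_sum]
    refine Finset.sum_congr rfl fun i _ => ?_
    push_cast; rw [mul_smul]
  rw [← hs, trBot_some] at hκ
  change _ + ∑ i ∈ Finset.range (m - (k + 1)), ((v * c (k + 1 + i) : ℤ) : ℤ[X]) •
      trBot p (a (k + 1 + i)) • δ (k + 1 + i) = _
  rw [h3]
  linear_combination (norm := module) (v : ℤ[X]) • hκ - h2 • trPoly p s • δ k

lemma smul_mem_of_mem_levelIdeal {i : ℕ} (hi : i < m) {g : ℤ[X]} (hg : g ∈ levelIdeal p (a i)) :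
    g • δ i ∈ mulSub A (p : ℤ[X]) := by
  obtain ⟨B, W, rfl⟩ := mem_levelIdeal.1 hg
  rw [add_smul, mul_comm, mul_smul, h.rep.level i hi, smul_zero, zero_add, mul_smul]
  exact smul_mem_mulSub _ _

lemma sum_sub_mem {g c : ℕ → ℤ[X]} (hgc : ∀ i < m, g i - c i ∈ levelIdeal p (a i)) :
    ∑ i ∈ Finset.range m, g i • δ i - ∑ i ∈ Finset.range m, c i • δ i
      ∈ mulSub A (p : ℤ[X]) := by
  rw [← Finset.sum_sub_distrib]
  refine Submodule.sum_mem _ fun i hi => ?_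
  rw [← sub_smul]
  exact h.smul_mem_of_mem_levelIdeal (Finset.mem_range.1 hi) (hgc i (Finset.mem_range.1 hi))

lemma mem_levelIdeal_of_sum_mem {g : ℕ → ℤ[X]}
    (hg : ∑ i ∈ Finset.range m, g i • δ i ∈ mulSub A (p : ℤ[X])) :
    ∀ i < m, g i ∈ levelIdeal p (a i) := by
  have key : ∀ (S : ℕ) (g : ℕ → ℤ[X]), (∀ i < m, (X - 1) ^ S * g i ∈ levelIdeal p (a i)) →
      ∑ i ∈ Finset.range m, g i • δ i ∈ mulSub A (p : ℤ[X]) →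
      ∀ i < m, g i ∈ levelIdeal p (a i) := by
    intro S
    induction S with
    | zero => intro g hg _ i hi; simpa using hg i hi
    | succ S ih =>
      intro g hS hg
      have h1 := ih (fun i => (X - 1) * g i)
        (fun i hi => by rw [← mul_assoc, ← pow_succ]; exact hS i hi) (by
          have := Submodule.smul_mem _ ((X : ℤ[X]) - 1) hg
          rw [Finset.smul_sum] at this
          simpa only [mul_smul] using this)
      have h2 : ∀ i, ∃ c : ℤ, i < m → g i - (c : ℤ[X]) * trBot p (a i) ∈ levelIdeal p (a i) := by
        intro i
        by_cases hi : i < m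
        · obtain ⟨c, hc⟩ := exists_sub_trBot_mem h.kummer.prime (a i) (h1 i hi)
          exact ⟨c, fun _ => hc⟩
        · exact ⟨0, fun h => absurd h hi⟩
      choose c hc using h2
      have h3 := h.sum_sub_mem hc
      have h4 := h.dvd_of_trace_mem c (by
        simpa only [mul_smul] using (Submodule.sub_mem_iff_right _ hg).1 h3)
      intro i hi
      by_cases hb : a i = ⊥
      · rw [hb]; exact mem_levelIdeal.2 ⟨g i, 0, by simp⟩
      · rw [← sub_add_cancel (g i) ((c i : ℤ[X]) * trBot p (a i))]
        refine add_mem (hc i hi) ?_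
        obtain ⟨w, hw⟩ := h4 i hi hb
        rw [hw]; push_cast; rw [mul_assoc]
        exact p_mul_mem_levelIdeal _ _ _
  exact key (p ^ n) g
    (fun i hi => sub_one_pow_mul_mem h.kummer.prime (h.vec.le i hi) _) hg

lemma sub_one_smul_trBot (i : ℕ) (hi : i < m) :
    ((X : ℤ[X]) - 1) • trBot p (a i) • δ i = 0 := by
  induction hs : a i using WithBot.recBotCoe with
  | bot => simp
  | coe s => exact trPoly_smul_fixed (h.level_coe hi hs)

lemma dvd_of_add_sum_mem {c : ℤ} {g : ℕ → ℤ[X]}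
    (hg : (c : ℤ[X]) • α + ∑ i ∈ Finset.range m, g i • δ i ∈ mulSub A (p : ℤ[X])) :
    (p : ℤ) ∣ c := by
  have h1 := h.eq_split h.vec.pos
  have h2 := h.norm_split h.vec.pos
  simp only [Finset.range_zero, Finset.sum_empty, normPoly_zero] at h1 h2
  set ψ := (e : ℤ[X]) • α + upperSum p m δ 0 with hψ
  have hα : ((X : ℤ[X]) - 1) • α = δ 0 + (p : ℤ[X]) • ψ := by
    linear_combination (norm := module) h1 - (p : ℤ[X]) • hψ
  have h3 : ∑ i ∈ Finset.range m, ((if i = 0 then (c : ℤ[X]) else 0) + (X - 1) * g i) • δ i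
      ∈ mulSub A (p : ℤ[X]) := by
    have h4 : ∑ i ∈ Finset.range m, ((if i = 0 then (c : ℤ[X]) else 0) + (X - 1) * g i) • δ i =
        (c : ℤ[X]) • δ 0 + ((X : ℤ[X]) - 1) • ∑ i ∈ Finset.range m, g i • δ i := by
      simp only [add_smul, Finset.sum_add_distrib, Finset.smul_sum, mul_smul]
      congr 1
      rw [Finset.sum_eq_single_of_mem 0 (by simpa using h.vec.pos)]
      · simp
      · intro b _ hb; simp [hb]
    rw [h4]
    have h5 := Submodule.smul_mem _ ((X : ℤ[X]) - 1) hg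
    have h6 := smul_mem_mulSub (p : ℤ[X]) (-(c : ℤ[X]) • ψ)
    have h7 := Submodule.add_mem _ h5 h6
    convert h7 using 1
    linear_combination (norm := module) -((c : ℤ[X]) • hα)
  have h4 := h.mem_levelIdeal_of_sum_mem h3
  by_cases hb : a 0 = ⊥
  · have hδ := h.eq_zero_of_bot h.vec.pos hb
    have h2' : ∀ i, ∃ c' : ℤ, i < m →
        g i - (c' : ℤ[X]) * trBot p (a i) ∈ levelIdeal p (a i) := by
      intro i
      by_cases hi : i < m
      · obtain ⟨c', hc'⟩ := exists_sub_trBot_mem h.kummer.prime (a i) (h := g i) (by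
          by_cases hi0 : i = 0
          · rw [hi0, hb]; exact mem_levelIdeal.2 ⟨(X - 1) * g 0, 0, by simp⟩
          · simpa [hi0] using h4 i hi)
        exact ⟨c', fun _ => hc'⟩
      · exact ⟨0, fun h => absurd h hi⟩
    choose c' hc' using h2'
    have h5 := Submodule.sub_mem _ hg (h.sum_sub_mem hc')
    obtain ⟨κ, hκ⟩ := mem_mulSub.1 h5
    have h6 : ((X : ℤ[X]) - 1) • ∑ i ∈ Finset.range m,
        ((c' i : ℤ[X]) * trBot p (a i)) • δ i = 0 := by
      rw [Finset.smul_sum]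
      refine Finset.sum_eq_zero fun i hi => ?_
      rw [mul_smul, smul_comm, h.sub_one_smul_trBot i (Finset.mem_range.1 hi), smul_zero]
    rw [hδ] at hα h2
    obtain ⟨w, hw⟩ := h.kummer.torsion ((c : ℤ[X]) • ψ - ((X : ℤ[X]) - 1) • κ) (by
      linear_combination (norm := module) ((X : ℤ[X]) - 1) • hκ - (c : ℤ[X]) • hα - h6)
    have h7 : trPoly p n • ξ = 0 := by
      rw [smul_fixed h.kummer.fixed, eval_one_trPoly]
      obtain ⟨k, hk⟩ : ∃ k, n = k + 1 := ⟨n - 1, by have := h.kummer.pos; omega⟩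
      rw [hk, pow_succ]
      push_cast
      rw [mul_smul, h.kummer.smul_eq_zero, smul_zero]
    have h8 := h.trPoly_X_sub_one κ
    refine h.kummer.int_dvd h.kummer.ne_zero h.kummer.smul_eq_zero ?_
    linear_combination (norm := module) trPoly p n • hw + h8 + (w : ℤ[X]) • h7
      - (c : ℤ[X]) • h2 - ((c : ℤ[X]) * trPoly p n) • hψ
  · obtain ⟨s, hs⟩ := WithBot.ne_bot_iff_exists.1 hb
    have h5 := h4 0 h.vec.pos
    rw [← hs] at h5
    obtain ⟨B, W, hBW⟩ := mem_levelIdeal.1 h5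
    rw [annPoly_some] at hBW
    have h6 := congrArg (eval 1) hBW
    simp at h6
    exact ⟨_, h6⟩

lemma eq_smul_sum : ((X : ℤ[X]) - (1 + (p : ℤ[X]) * (e : ℤ[X]))) • α =
    ∑ i ∈ Finset.range m, (p : ℤ[X]) ^ i • δ i + (p : ℤ[X]) ^ m • δ m := by
  rw [h.rep.eq, Finset.sum_range_succ]

lemma sum_smul_eq {q : ℤ[X]} {B : ℕ → ℤ[X]} {g W : ℕ → ℤ[X]} {r : ℤ[X]}
    (hg : ∀ i < m, g i = -q * (p : ℤ[X]) ^ i + annPoly p (a i) * B i + r * W i) :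
    ∑ i ∈ Finset.range m, g i • δ i = -q • ∑ i ∈ Finset.range m, (p : ℤ[X]) ^ i • δ i +
      r • ∑ i ∈ Finset.range m, W i • δ i := by
  simp only [Finset.smul_sum, ← Finset.sum_add_distrib]
  refine Finset.sum_congr rfl fun i hi => ?_
  have hi' := Finset.mem_range.1 hi
  linear_combination (norm := module) (hg i hi') • δ i + B i • h.rep.level i hi'

/-- The relations modulo `p` between the generators of an exceptional module. -/
lemma relation_mod_p {u : ℤ[X]} {g : ℕ → ℤ[X]}
    (hg : u • α + ∑ i ∈ Finset.range m, g i • δ i ∈ mulSub A (p : ℤ[X])) :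
    ∃ (q w : ℤ[X]) (B W : ℕ → ℤ[X]), u = q * (X - (1 + (p : ℤ[X]) * (e : ℤ[X]))) + (p : ℤ[X]) * w ∧
      ∀ i < m, g i = -q * (p : ℤ[X]) ^ i + annPoly p (a i) * B i + (p : ℤ[X]) * W i := by
  obtain ⟨q, hq⟩ : X - C (1 + p * e : ℤ) ∣ u - C (u.eval (1 + p * e : ℤ)) := by
    rw [dvd_iff_isRoot]; simp
  set c := u.eval (1 + p * e : ℤ) with hc
  have hq' : u = q * (X - (1 + (p : ℤ[X]) * (e : ℤ[X]))) + (c : ℤ[X]) := by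
    have h1 : (C c : ℤ[X]) = (c : ℤ[X]) := by simp
    have h2 : (C (1 + p * e : ℤ) : ℤ[X]) = 1 + (p : ℤ[X]) * (e : ℤ[X]) := by simp
    rw [h1, h2] at hq
    linear_combination hq
  have hsum : ∑ i ∈ Finset.range m, (g i + q * (p : ℤ[X]) ^ i) • δ i =
      ∑ i ∈ Finset.range m, g i • δ i + q • ∑ i ∈ Finset.range m, (p : ℤ[X]) ^ i • δ i := by
    simp only [Finset.smul_sum, ← Finset.sum_add_distrib]
    exact Finset.sum_congr rfl fun i _ => by module
  have hmem : (c : ℤ[X]) • α + ∑ i ∈ Finset.range m, (g i + q * (p : ℤ[X]) ^ i) • δ i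
      ∈ mulSub A (p : ℤ[X]) := by
    have h1 : (q * (p : ℤ[X]) ^ m) • δ m ∈ mulSub A (p : ℤ[X]) :=
      smul_mem_mulSub_of_dvd ((dvd_pow_self _ h.vec.pos.ne').mul_left _) _
    have h2 := Submodule.sub_mem _ hg h1
    convert h2 using 1
    rw [hsum]
    linear_combination (norm := module) -(hq' • α) - q • h.eq_smul_sum
  obtain ⟨w, hw⟩ := h.dvd_of_add_sum_mem hmem
  have hcα : (c : ℤ[X]) • α ∈ mulSub A (p : ℤ[X]) :=
    smul_mem_mulSub_of_dvd (by rw [hw]; push_cast; exact dvd_mul_right _ _) _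
  have h3 := h.mem_levelIdeal_of_sum_mem ((Submodule.add_mem_iff_right _ hcα).1 hmem)
  have h4 : ∀ i, ∃ B W : ℤ[X], i < m →
      g i + q * (p : ℤ[X]) ^ i = annPoly p (a i) * B + (p : ℤ[X]) * W := by
    intro i
    by_cases hi : i < m
    · obtain ⟨B, W, hBW⟩ := mem_levelIdeal.1 (h3 i hi)
      exact ⟨B, W, fun _ => hBW⟩
    · exact ⟨0, 0, fun h => absurd h hi⟩
  choose B W hBW using h4
  refine ⟨q, w, B, W, ?_, fun i hi => ?_⟩
  · rw [hq', hw]; push_cast; ring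
  · linear_combination hBW i hi

/-- All relations modulo `p ^ k` between the generators of an exceptional module. -/
lemma relation_mod_pow (k : ℕ) (hk : k ≤ m) {u : ℤ[X]} {g : ℕ → ℤ[X]}
    (hg : u • α + ∑ i ∈ Finset.range m, g i • δ i ∈ mulSub A ((p : ℤ[X]) ^ k)) :
    ∃ (q w D : ℤ[X]) (B W : ℕ → ℤ[X]),
      u = q * (X - (1 + (p : ℤ[X]) * (e : ℤ[X]))) + (p : ℤ[X]) ^ k * w + (X ^ p ^ n - 1) * D ∧
      ∀ i < m, g i = -q * (p : ℤ[X]) ^ i + annPoly p (a i) * B i + (p : ℤ[X]) ^ k * W i := by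
  induction k generalizing u g with
  | zero => exact ⟨0, u, 0, 0, g, by simp, by simp⟩
  | succ k ih =>
    obtain ⟨κ, hκ⟩ := mem_mulSub.1 hg
    obtain ⟨q, w, B, W, hu, hgi⟩ := h.relation_mod_p (u := u) (g := g) (by
      rw [hκ]; exact smul_mem_mulSub_of_dvd (dvd_pow_self _ k.succ_ne_zero) _)
    have h1 := h.eq_smul_sum
    have h2 := h.sum_smul_eq hgi
    have h3 := h.rep.norm
    obtain ⟨l, rfl⟩ : ∃ l, m = l + 1 := ⟨m - 1, by omega⟩
    rw [Finset.sum_range_succ, normPoly_succ] at h3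
    obtain ⟨c, hc⟩ := h.kummer.torsion (w • α + ∑ i ∈ Finset.range (l + 1), W i • δ i +
      (q * (p : ℤ[X]) ^ l) • δ (l + 1) - (p : ℤ[X]) ^ k • κ) (by
        linear_combination (norm := module) hκ - hu • α - q • h1 - h2)
    have hsum : ∑ i ∈ Finset.range (l + 1), (W i - (c : ℤ[X]) * normPoly p n i) • δ i =
        ∑ i ∈ Finset.range (l + 1), W i • δ i -
        (c : ℤ[X]) • ∑ i ∈ Finset.range (l + 1), normPoly p n i • δ i := by
      simp only [Finset.smul_sum, ← Finset.sum_sub_distrib]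
      exact Finset.sum_congr rfl fun i _ => by module
    obtain ⟨q', w', D', B', W', hu', hgi'⟩ := ih (by omega)
      (u := w - (c : ℤ[X]) * (e : ℤ[X]) * trPoly p n)
      (g := fun i => W i - (c : ℤ[X]) * normPoly p n i) (by
        have hkl : (p : ℤ[X]) ^ k ∣ (p : ℤ[X]) ^ l := pow_dvd_pow _ (by omega)
        have h4 := Submodule.add_mem _ (smul_mem_mulSub ((p : ℤ[X]) ^ k) κ)
          (smul_mem_mulSub_of_dvd (hkl.mul_left ((c : ℤ[X]) * trPoly p n - q)) (δ (l + 1)))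
        convert h4 using 1
        rw [hsum]
        linear_combination (norm := module) hc - (c : ℤ[X]) • h3)
    have h5 : ∀ i, ∃ B'' : ℤ[X], i < l + 1 → (p : ℤ[X]) * normPoly p n i =
        (p : ℤ[X]) ^ i * trPoly p n + annPoly p (a i) * B'' := by
      intro i
      by_cases hi : i < l + 1
      · obtain ⟨b, hb⟩ := exists_p_mul_normPoly h.kummer.pos h.vec.lt (p := p) i
        exact ⟨b, fun _ => hb⟩
      · exact ⟨0, fun h => absurd h hi⟩
    choose B'' hB'' using h5
    refine ⟨q + p * q' - (c : ℤ[X]) * trPoly p n, w', p * D' + (c : ℤ[X]),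
      fun i => B i + p * B' i + (c : ℤ[X]) * B'' i, W', ?_, fun i hi => ?_⟩
    · have hX := trPoly_mul p n
      linear_combination hu + (p : ℤ[X]) * hu' + (c : ℤ[X]) * hX
    · linear_combination hgi i hi + (p : ℤ[X]) * hgi' i hi + (c : ℤ[X]) * hB'' i hi

end MinRep

end RelationsTheory

section IndecomposabilityTheory

open Polynomial

variable {A : Type*} [AddCommGroup A] [Module ℤ[X] A]

lemma dvd_of_dvd_pow_mul {p : ℕ} (hp : p.Prime) {P : ℤ[X]} (hP : P.Monic) (k : ℕ) {f : ℤ[X]}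
    (h : P ∣ (p : ℤ[X]) ^ k * f) : P ∣ f := by
  rw [← modByMonic_eq_zero_iff_dvd hP] at h ⊢
  have h1 : (p : ℤ[X]) ^ k * f = ((p : ℤ) ^ k) • f := by
    rw [zsmul_eq_mul]; push_cast; rfl
  rw [h1, smul_modByMonic] at h
  exact (smul_eq_zero.1 h).resolve_left (pow_ne_zero _ (by exact_mod_cast hp.ne_zero))

lemma annPoly_monic {p : ℕ} (hp : p.Prime) (a : WithBot ℕ) : (annPoly p a).Monic := by
  induction a using WithBot.recBotCoe with
  | bot => exact monic_one
  | coe s => exact monic_X_pow_sub_one hp s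

/-- The linear combinations of `α, δ 0, …, δ (m - 1)`. -/
noncomputable def comb (m : ℕ) (α : A) (δ : ℕ → A) : ℤ[X] × (ℕ → ℤ[X]) →ₗ[ℤ[X]] A where
  toFun x := x.1 • α + ∑ i ∈ Finset.range m, x.2 i • δ i
  map_add' x y := by
    simp only [Prod.fst_add, Prod.snd_add, Pi.add_apply, add_smul, Finset.sum_add_distrib]
    abel
  map_smul' r x := by
    simp only [Prod.smul_fst, Prod.smul_snd, Pi.smul_apply, smul_eq_mul, RingHom.id_apply,
      smul_add, Finset.smul_sum, mul_smul]

lemma comb_apply (m : ℕ) (α : A) (δ : ℕ → A) (u : ℤ[X]) (g : ℕ → ℤ[X]) :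
    comb m α δ (u, g) = u • α + ∑ i ∈ Finset.range m, g i • δ i := rfl

lemma comb_mem {m : ℕ} {α : A} {δ : ℕ → A} {S : Submodule ℤ[X] A} (hα : α ∈ S)
    (hδ : ∀ i < m, δ i ∈ S) (x : ℤ[X] × (ℕ → ℤ[X])) : comb m α δ x ∈ S := by
  rw [← Prod.mk.eta (p := x), comb_apply]
  exact add_mem (S.smul_mem _ hα)
    (sum_mem fun i hi => S.smul_mem _ (hδ i (Finset.mem_range.1 hi)))

/-- The submodule generated by `α, δ 0, …, δ (m - 1)` and all `p ^ m`-th multiples. -/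
noncomputable def excSub (p m : ℕ) (α : A) (δ : ℕ → A) : Submodule ℤ[X] A :=
  LinearMap.range (comb m α δ) ⊔ mulSub A ((p : ℤ[X]) ^ m)

lemma mem_excSub {p m : ℕ} {α : A} {δ : ℕ → A} {x : A} :
    x ∈ excSub p m α δ ↔ ∃ y κ, x = comb m α δ y + (p : ℤ[X]) ^ m • κ := by
  simp only [excSub, Submodule.mem_sup, LinearMap.mem_range, mem_mulSub]
  constructor
  · rintro ⟨_, ⟨y, rfl⟩, _, ⟨κ, rfl⟩, rfl⟩
    exact ⟨y, κ, rfl⟩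
  · rintro ⟨y, κ, rfl⟩
    exact ⟨_, ⟨y, rfl⟩, _, ⟨κ, rfl⟩, rfl⟩

lemma left_mem_excSub (p m : ℕ) (α : A) (δ : ℕ → A) : α ∈ excSub p m α δ :=
  mem_excSub.2 ⟨(1, 0), 0, by simp [comb_apply]⟩

lemma mem_excSub_of_lt (p : ℕ) {m : ℕ} (α : A) (δ : ℕ → A) {i : ℕ} (hi : i < m) :
    δ i ∈ excSub p m α δ := by
  refine mem_excSub.2 ⟨(0, Pi.single i 1), 0, ?_⟩
  rw [comb_apply, Finset.sum_eq_single_of_mem i (by simpa using hi)]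
  · simp
  · intro j _ hj; simp [Pi.single_eq_of_ne hj]

lemma finite_quotient_levelIdeal {p : ℕ} (hp : p.Prime) (n : ℕ) :
    Finite (ℤ[X] ⧸ levelIdeal p (n : WithBot ℕ)) := by
  have h1 : Module.Finite ℤ (ℤ[X] ⧸ Ideal.span {(X ^ p ^ n - 1 : ℤ[X])}) :=
    (monic_X_pow_sub_one hp n).finite_quotient
  have hle : Ideal.span {(X ^ p ^ n - 1 : ℤ[X])} ≤ levelIdeal p (n : WithBot ℕ) := by
    rw [Ideal.span_le, Set.singleton_subset_iff]
    exact mem_levelIdeal.2 ⟨1, 0, by simp⟩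
  have h2 : Module.Finite ℤ (ℤ[X] ⧸ levelIdeal p (n : WithBot ℕ)) :=
    Module.Finite.of_surjective ((Ideal.Quotient.factor hle).toAddMonoidHom.toIntLinearMap)
      (Ideal.Quotient.factor_surjective hle)
  refine Module.finite_of_fg_torsion _ fun x => ?_
  obtain ⟨f, rfl⟩ := Ideal.Quotient.mk_surjective x
  refine ⟨⟨p, mem_nonZeroDivisors_of_ne_zero (by exact_mod_cast hp.ne_zero)⟩, ?_⟩
  rw [Submonoid.mk_smul]
  rw [← map_zsmul, Ideal.Quotient.eq_zero_iff_mem, zsmul_eq_mul]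
  exact_mod_cast p_mul_mem_levelIdeal p _ f

lemma IsRep.norm_torsion {p n m : ℕ} {a : ℕ → WithBot ℕ} {e : ℤ} {α : A} {δ : ℕ → A} {lam : A}
    (r : IsRep p n m a e α δ lam) (hn : 0 < n) (hm : 0 < m) (ha : a 0 < n)
    (hann : ∀ x : A, (X ^ p ^ n - 1 : ℤ[X]) • x = 0) : (p : ℤ[X]) • lam = 0 := by
  have h1 := r.eq
  rw [← r.norm]
  have h2 : (p : ℤ[X]) • ∑ i ∈ Finset.range (m + 1), normPoly p n i • δ i =
      trPoly p n • ∑ i ∈ Finset.range (m + 1), (p : ℤ[X]) ^ i • δ i := by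
    simp only [Finset.smul_sum]
    refine Finset.sum_congr rfl fun i hi => ?_
    rcases (Finset.mem_range_succ_iff.1 hi).lt_or_eq with hlt | rfl
    · obtain ⟨B, hB⟩ := exists_p_mul_normPoly (p := p) hn ha i
      linear_combination (norm := module) hB • δ i + B • r.level i hlt
    · obtain ⟨l, rfl⟩ : ∃ l, i = l + 1 := ⟨i - 1, by omega⟩
      rw [normPoly_succ]; module
  have h3 := trPoly_mul p n
  linear_combination (norm := module) h2 - trPoly p n • h1 + h3 • α + hann α

namespace MinRep

variable {p n m : ℕ} {a : ℕ → WithBot ℕ} {e : ℤ} {α : A} {δ : ℕ → A} {ξ : A}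
  (h : MinRep p n m a e α δ ξ)
include h

lemma comb_eq_of_relation {k : ℕ} {u q w D : ℤ[X]} {g B W : ℕ → ℤ[X]}
    (hu : u = q * (X - (1 + (p : ℤ[X]) * (e : ℤ[X]))) + (p : ℤ[X]) ^ k * w + (X ^ p ^ n - 1) * D)
    (hg : ∀ i < m, g i = -q * (p : ℤ[X]) ^ i + annPoly p (a i) * B i + (p : ℤ[X]) ^ k * W i) :
    comb m α δ (u, g) = (p : ℤ[X]) ^ m • q • δ m + (p : ℤ[X]) ^ k • comb m α δ (w, W) := by
  rw [comb_apply, comb_apply]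
  linear_combination (norm := module) hu • α + q • h.eq_smul_sum + h.sum_smul_eq hg
    + D • h.kummer.ann α

lemma exists_annPoly_smul_comb_eq {x : ℤ[X] × (ℕ → ℤ[X])} {i : ℕ} (hi : i < m)
    (hx : annPoly p (a i) • comb m α δ x ∈ mulSub A ((p : ℤ[X]) ^ m)) :
    ∃ v : A, annPoly p (a i) • comb m α δ x = (p : ℤ[X]) ^ (m - i) • annPoly p (a i) • v := by
  obtain ⟨c, g⟩ := x
  set P := annPoly p (a i) with hP
  have hPm : P.Monic := annPoly_monic h.kummer.prime _
  have hsm : P • comb m α δ (c, g) = comb m α δ (P * c, fun j => P * g j) := by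
    rw [← map_smul]; rfl
  rw [hsm] at hx ⊢
  obtain ⟨q, w, D, B, W, hu, hg⟩ := h.relation_mod_pow m le_rfl hx
  rw [h.comb_eq_of_relation hu hg]
  have hgi := hg i hi
  rw [← hP] at hgi
  obtain ⟨N, hN⟩ : P ∣ X ^ p ^ n - 1 := annPoly_dvd_annPoly (h.vec.le i hi)
  obtain ⟨Q, hQ⟩ : P ∣ (p : ℤ[X]) ^ i * w + W i * (X - (1 + (p : ℤ[X]) * (e : ℤ[X]))) := by
    refine dvd_of_dvd_pow_mul h.kummer.prime hPm m
      ⟨(p : ℤ[X]) ^ i * c - (B i - g i) * (X - (1 + (p : ℤ[X]) * (e : ℤ[X])))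
        - (p : ℤ[X]) ^ i * N * D, ?_⟩
    linear_combination -(p : ℤ[X]) ^ i * hu - (X - (1 + (p : ℤ[X]) * (e : ℤ[X]))) * hgi
      - (p : ℤ[X]) ^ i * D * hN
  have hE : ∀ j, ∃ v : A, j < m → ((p : ℤ[X]) ^ i * W j - (p : ℤ[X]) ^ j * W i) • δ j = P • v := by
    intro j
    by_cases hj : j < m
    · have hgj := hg j hj
      have key : (p : ℤ[X]) ^ m * ((p : ℤ[X]) ^ i * W j - (p : ℤ[X]) ^ j * W i) =
          P * ((p : ℤ[X]) ^ i * g j + (p : ℤ[X]) ^ j * (B i - g i))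
            - (p : ℤ[X]) ^ i * annPoly p (a j) * B j := by
        linear_combination -(p : ℤ[X]) ^ i * hgj + (p : ℤ[X]) ^ j * hgi
      rcases le_total (a i) (a j) with hij | hij
      · obtain ⟨R, hR⟩ := annPoly_dvd_annPoly (p := p) hij
        obtain ⟨V, hV⟩ := dvd_of_dvd_pow_mul h.kummer.prime hPm m (f := (p : ℤ[X]) ^ i * W j -
          (p : ℤ[X]) ^ j * W i) (by
            rw [key, hR]
            exact dvd_sub (dvd_mul_right _ _) ⟨(p : ℤ[X]) ^ i * R * B j, by ring⟩)
        exact ⟨V • δ j, fun _ => by rw [hV, mul_smul]⟩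
      · obtain ⟨R, hR⟩ := annPoly_dvd_annPoly (p := p) hij
        obtain ⟨V, hV⟩ := dvd_of_dvd_pow_mul h.kummer.prime (annPoly_monic h.kummer.prime (a j)) m
          (f := (p : ℤ[X]) ^ i * W j - (p : ℤ[X]) ^ j * W i) (by
            rw [key, hP, hR]
            exact dvd_sub ⟨R * ((p : ℤ[X]) ^ i * g j + (p : ℤ[X]) ^ j * (B i - g i)), by ring⟩
              ⟨(p : ℤ[X]) ^ i * B j, by ring⟩)
        exact ⟨0, fun _ => by
          rw [hV, mul_comm, mul_smul, h.rep.level j hj, smul_zero, smul_zero]⟩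
    · exact ⟨0, fun h => absurd h hj⟩
  choose v hv using hE
  have hsum : (p : ℤ[X]) ^ i • ∑ j ∈ Finset.range m, W j • δ j
      - W i • ∑ j ∈ Finset.range m, (p : ℤ[X]) ^ j • δ j = P • ∑ j ∈ Finset.range m, v j := by
    simp only [Finset.smul_sum, ← Finset.sum_sub_distrib]
    refine Finset.sum_congr rfl fun j hj => ?_
    rw [← hv j (Finset.mem_range.1 hj)]; module
  refine ⟨(B i - g i) • δ m + Q • α + ∑ j ∈ Finset.range m, v j, ?_⟩
  have hmi : (p : ℤ[X]) ^ m = (p : ℤ[X]) ^ (m - i) * (p : ℤ[X]) ^ i := by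
    rw [← pow_add, Nat.sub_add_cancel hi.le]
  have hw : (p : ℤ[X]) ^ i • (q • δ m + comb m α δ (w, W)) =
      P • ((B i - g i) • δ m + Q • α + ∑ j ∈ Finset.range m, v j) := by
    rw [comb_apply]
    linear_combination (norm := module) hsum + hQ • α - W i • h.eq_smul_sum + hgi • δ m
  rw [← hw, hmi]
  module

/-- An element of the exceptional module killed by the annihilator polynomial of level `a i`
modulo `p ^ m` is congruent modulo `p ^ (m - i)` to an element of level `a i`. -/
lemma exists_lift {x : A} (hxE : x ∈ excSub p m α δ) {i : ℕ} (hi : i < m)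
    (hx : annPoly p (a i) • x ∈ mulSub A ((p : ℤ[X]) ^ m)) :
    ∃ γ v : A, annPoly p (a i) • γ = 0 ∧ x = γ + (p : ℤ[X]) ^ (m - i) • v := by
  obtain ⟨y, κ, rfl⟩ := mem_excSub.1 hxE
  have h1 : annPoly p (a i) • (p : ℤ[X]) ^ m • κ ∈ mulSub A ((p : ℤ[X]) ^ m) := by
    rw [smul_comm]; exact smul_mem_mulSub _ _
  rw [smul_add, Submodule.add_mem_iff_left _ h1] at hx
  obtain ⟨v, hv⟩ := h.exists_annPoly_smul_comb_eq hi hx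
  refine ⟨comb m α δ y - (p : ℤ[X]) ^ (m - i) • v, v + (p : ℤ[X]) ^ i • κ, ?_, ?_⟩
  · rw [smul_sub, hv, smul_comm, sub_self]
  · have hmi : (p : ℤ[X]) ^ m = (p : ℤ[X]) ^ (m - i) * (p : ℤ[X]) ^ i := by
      rw [← pow_add, Nat.sub_add_cancel hi.le]
    rw [hmi]; module

lemma comb_mem_mulSub_iff (u : ℤ[X]) (g : ℕ → ℤ[X]) :
    comb m α δ (u, g) ∈ mulSub A (p : ℤ[X]) ↔ ∃ (q w : ℤ[X]) (B W : ℕ → ℤ[X]),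
      u = q * (X - (1 + (p : ℤ[X]) * (e : ℤ[X]))) + (p : ℤ[X]) * w ∧
      ∀ i < m, g i = -q * (p : ℤ[X]) ^ i + annPoly p (a i) * B i + (p : ℤ[X]) * W i := by
  refine ⟨h.relation_mod_p, ?_⟩
  rintro ⟨q, w, B, W, hu, hg⟩
  rw [h.comb_eq_of_relation (k := 1) (w := w) (D := 0) (W := W) (q := q) (B := B)
    (by rw [hu]; ring) (fun i hi => by rw [hg i hi]; ring), pow_one]
  exact add_mem (smul_mem_mulSub_of_dvd (dvd_pow_self _ h.vec.pos.ne') _) (smul_mem_mulSub _ _)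

lemma smul_mem_of_mem_levelIdeal_top {g : ℤ[X]} (hg : g ∈ levelIdeal p (n : WithBot ℕ)) (x : A) :
    g • x ∈ mulSub A (p : ℤ[X]) := by
  obtain ⟨B, W, rfl⟩ := mem_levelIdeal.1 hg
  rw [add_smul, mul_comm, mul_smul, annPoly_coe, h.kummer.ann, smul_zero, zero_add, mul_smul]
  exact smul_mem_mulSub _ _

lemma finite_range : Finite (LinearMap.range ((mulSub A (p : ℤ[X])).mkQ ∘ₗ comb m α δ)) := by
  have hfin := finite_quotient_levelIdeal h.kummer.prime n
  let Q := ℤ[X] ⧸ levelIdeal p (n : WithBot ℕ)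
  let F : Q × (Fin m → Q) → A ⧸ mulSub A (p : ℤ[X]) := fun x =>
    (mulSub A (p : ℤ[X])).mkQ (comb m α δ (Quotient.out x.1, fun i =>
      if hi : i < m then Quotient.out (x.2 ⟨i, hi⟩) else 0))
  have hout : ∀ g : ℤ[X], Quotient.out (Ideal.Quotient.mk (levelIdeal p (n : WithBot ℕ)) g) - g
      ∈ levelIdeal p (n : WithBot ℕ) := fun g => by
    rw [← Ideal.Quotient.eq]
    exact Quotient.out_eq _
  have hsub : ((LinearMap.range ((mulSub A (p : ℤ[X])).mkQ ∘ₗ comb m α δ) : Submodule _ _) :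
      Set (A ⧸ mulSub A (p : ℤ[X]))) ⊆ Set.range F := by
    rintro _ ⟨⟨u, g⟩, rfl⟩
    refine ⟨(Ideal.Quotient.mk _ u, fun i => Ideal.Quotient.mk _ (g i)), ?_⟩
    simp only [F, LinearMap.comp_apply, Submodule.mkQ_apply]
    rw [Submodule.Quotient.eq, ← map_sub]
    change comb m α δ (_, _) ∈ _
    rw [comb_apply]
    refine add_mem (h.smul_mem_of_mem_levelIdeal_top (hout _) _) (sum_mem fun i hi => ?_)
    refine h.smul_mem_of_mem_levelIdeal_top ?_ _
    simp only [Pi.sub_apply, Finset.mem_range.1 hi, dite_true]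
    exact hout _
  exact ((Set.finite_range F).subset hsub).to_subtype

/-- If one summand of a decomposition contains, up to `p`-th multiples, a solution of the norm
pair equations, then the other one is trivial. -/
lemma le_of_rep {S S' : Submodule ℤ[X] A} (hinf : S ⊓ S' = mulSub A ((p : ℤ[X]) ^ m))
    (hsup : S ⊔ S' = excSub p m α δ) {α' : A} {δ' : ℕ → A} {lam : A}
    (h' : MinRep p n m a e α' δ' lam) (hα' : α' ∈ S)
    (hδ' : ∀ i < m, δ' i ∈ S ⊔ mulSub A (p : ℤ[X])) : S' ≤ mulSub A ((p : ℤ[X]) ^ m) := by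
  have hpm : mulSub A ((p : ℤ[X]) ^ m) ≤ mulSub A (p : ℤ[X]) := by
    intro x hx
    obtain ⟨κ, rfl⟩ := mem_mulSub.1 hx
    exact smul_mem_mulSub_of_dvd (dvd_pow_self _ h.vec.pos.ne') _
  have hSE : S ≤ excSub p m α δ := hsup ▸ le_sup_left
  set π := (mulSub A (p : ℤ[X])).mkQ with hπ
  have hker : LinearMap.ker (π ∘ₗ comb m α δ) = LinearMap.ker (π ∘ₗ comb m α' δ') := by
    ext ⟨u, g⟩
    rw [LinearMap.mem_ker, LinearMap.mem_ker, LinearMap.comp_apply, LinearMap.comp_apply, hπ,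
      Submodule.mkQ_apply, Submodule.mkQ_apply, Submodule.Quotient.mk_eq_zero,
      Submodule.Quotient.mk_eq_zero, h.comb_mem_mulSub_iff, h'.comb_mem_mulSub_iff]
  have hEp : ∀ x ∈ S ⊔ mulSub A (p : ℤ[X]), π x ∈ LinearMap.range (π ∘ₗ comb m α δ) := by
    intro x hx
    obtain ⟨y, hy, z, hz, rfl⟩ := Submodule.mem_sup.1 hx
    obtain ⟨w, κ, rfl⟩ := mem_excSub.1 (hSE hy)
    refine ⟨w, ?_⟩
    have hz' : π z = 0 := (Submodule.Quotient.mk_eq_zero _).2 hz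
    have hκ : π ((p : ℤ[X]) ^ m • κ) = 0 :=
      (Submodule.Quotient.mk_eq_zero _).2 (hpm (smul_mem_mulSub _ _))
    rw [map_add, map_add, hz', hκ, add_zero, add_zero]; rfl
  have hle : LinearMap.range (π ∘ₗ comb m α' δ') ≤ LinearMap.range (π ∘ₗ comb m α δ) := by
    rintro _ ⟨y, rfl⟩
    exact hEp _ (comb_mem (Submodule.mem_sup_left hα') hδ' y)
  have hfin := h.finite_range
  have heq : LinearMap.range (π ∘ₗ comb m α' δ') = LinearMap.range (π ∘ₗ comb m α δ) := by
    apply SetLike.coe_injective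
    refine Set.eq_of_subset_of_ncard_le hle (le_of_eq ?_) hfin
    exact Nat.card_congr (((π ∘ₗ comb m α δ).quotKerEquivRange.symm.trans
      (Submodule.quotEquivOfEq _ _ hker)).trans (π ∘ₗ comb m α' δ').quotKerEquivRange).toEquiv
  have hES : excSub p m α δ ≤ S ⊔ mulSub A (p : ℤ[X]) := by
    intro x hx
    obtain ⟨y, κ, rfl⟩ := mem_excSub.1 hx
    have h1 : (π ∘ₗ comb m α δ) y ∈ LinearMap.range (π ∘ₗ comb m α' δ') := heq ▸ ⟨y, rfl⟩
    obtain ⟨y', hy'⟩ := h1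
    have h2 : comb m α δ y - comb m α' δ' y' ∈ mulSub A (p : ℤ[X]) := by
      rw [← Submodule.Quotient.eq]; exact hy'.symm
    have h3 := comb_mem (Submodule.mem_sup_left hα') hδ' y'
    rw [← sub_add_cancel (comb m α δ y) (comb m α' δ' y')]
    exact add_mem (add_mem (Submodule.mem_sup_right h2) h3)
      (Submodule.mem_sup_right (hpm (smul_mem_mulSub _ _)))
  have hstep : ∀ s ∈ S', ∃ t ∈ S', s - (p : ℤ[X]) • t ∈ mulSub A ((p : ℤ[X]) ^ m) := by
    intro s hs
    have hsE : s ∈ excSub p m α δ := hsup ▸ Submodule.mem_sup_right hs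
    obtain ⟨s₁, hs₁, z, hz, hsz⟩ := Submodule.mem_sup.1 (hES hsE)
    have hzE : z ∈ excSub p m α δ := by
      rw [show z = s - s₁ by rw [← hsz]; abel]
      exact sub_mem hsE (hSE hs₁)
    obtain ⟨⟨u, g⟩, κ, rfl⟩ := mem_excSub.1 hzE
    have h1 := (Submodule.add_mem_iff_left _ (hpm (smul_mem_mulSub _ κ))).1 hz
    obtain ⟨q, w, B, W, hu, hg⟩ := (h.comb_mem_mulSub_iff u g).1 h1
    have h2 := h.comb_eq_of_relation (k := 1) (w := w) (D := 0) (W := W) (q := q) (B := B)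
      (u := u) (g := g) (by rw [hu]; ring) (fun i hi => by rw [hg i hi]; ring)
    rw [pow_one] at h2
    have h3 : comb m α δ (w, W) ∈ S ⊔ S' := by
      rw [hsup]; exact mem_excSub.2 ⟨(w, W), 0, by simp⟩
    obtain ⟨e₁, he₁, e₂, he₂, he⟩ := Submodule.mem_sup.1 h3
    refine ⟨e₂, he₂, ?_⟩
    rw [← hinf]
    have hP : (p : ℤ[X]) ^ m • (q • δ m + κ) ∈ S ⊓ S' := hinf ▸ smul_mem_mulSub _ _
    refine ⟨?_, sub_mem hs (S'.smul_mem _ he₂)⟩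
    have h4 := add_mem (add_mem hs₁ (S.smul_mem (p : ℤ[X]) he₁)) hP.1
    have h5 : s - (p : ℤ[X]) • e₂ = s₁ + (p : ℤ[X]) • e₁ + (p : ℤ[X]) ^ m • (q • δ m + κ) := by
      linear_combination (norm := module) -hsz + h2 - (p : ℤ[X]) • he
    rw [h5]
    exact h4
  have hiter : ∀ k : ℕ, ∀ s ∈ S', ∃ t ∈ S',
      s - (p : ℤ[X]) ^ k • t ∈ mulSub A ((p : ℤ[X]) ^ m) := by
    intro k
    induction k with
    | zero => intro s hs; exact ⟨s, hs, by simp⟩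
    | succ k ih =>
      intro s hs
      obtain ⟨t, ht, hst⟩ := ih s hs
      obtain ⟨t', ht', htt'⟩ := hstep t ht
      refine ⟨t', ht', ?_⟩
      have h1 := add_mem hst (Submodule.smul_mem _ ((p : ℤ[X]) ^ k) htt')
      convert h1 using 1
      module
  intro s hs
  obtain ⟨t, -, ht⟩ := hiter m s hs
  have h1 := add_mem ht (smul_mem_mulSub ((p : ℤ[X]) ^ m) t)
  rwa [sub_add_cancel] at h1

lemma indecomposable {S S' : Submodule ℤ[X] A} (hinf : S ⊓ S' = mulSub A ((p : ℤ[X]) ^ m))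
    (hsup : S ⊔ S' = excSub p m α δ) :
    S ≤ mulSub A ((p : ℤ[X]) ^ m) ∨ S' ≤ mulSub A ((p : ℤ[X]) ^ m) := by
  have hPS : mulSub A ((p : ℤ[X]) ^ m) ≤ S := hinf ▸ inf_le_left
  have hPS' : mulSub A ((p : ℤ[X]) ^ m) ≤ S' := hinf ▸ inf_le_right
  have hSE : S ≤ excSub p m α δ := hsup ▸ le_sup_left
  obtain ⟨α₁, hα₁, α₂, hα₂, hα⟩ := Submodule.mem_sup.1
    (hsup.symm ▸ left_mem_excSub p m α δ : α ∈ S ⊔ S')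
  have hx : ∀ i, ∃ x y : A, i < m → x ∈ S ∧ y ∈ S' ∧ x + y = δ i := by
    intro i
    by_cases hi : i < m
    · obtain ⟨x, hx, y, hy, hxy⟩ := Submodule.mem_sup.1
        (hsup.symm ▸ mem_excSub_of_lt p α δ hi : δ i ∈ S ⊔ S')
      exact ⟨x, y, fun _ => ⟨hx, hy, hxy⟩⟩
    · exact ⟨0, 0, fun h => absurd h hi⟩
  choose x y hxy using hx
  have hγ : ∀ i, ∃ γ v : A, i < m →
      annPoly p (a i) • γ = 0 ∧ x i = γ + (p : ℤ[X]) ^ (m - i) • v := by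
    intro i
    by_cases hi : i < m
    · obtain ⟨hxS, hyS, hsum⟩ := hxy i hi
      have h1 : annPoly p (a i) • x i ∈ mulSub A ((p : ℤ[X]) ^ m) := by
        rw [← hinf]
        refine ⟨S.smul_mem _ hxS, ?_⟩
        have h2 : annPoly p (a i) • x i = -(annPoly p (a i) • y i) := by
          linear_combination (norm := module) annPoly p (a i) • hsum + h.rep.level i hi
        rw [h2]
        exact neg_mem (S'.smul_mem _ hyS)
      obtain ⟨γ, v, hγ, hv⟩ := h.exists_lift (hSE hxS) hi h1
      exact ⟨γ, v, fun _ => ⟨hγ, hv⟩⟩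
    · exact ⟨0, 0, fun h => absurd h hi⟩
  choose γ v hγv using hγ
  set σd : ℤ[X] := (X : ℤ[X]) - (1 + (p : ℤ[X]) * (e : ℤ[X])) with hσd
  have hsumxy : ∑ i ∈ Finset.range m, (p : ℤ[X]) ^ i • x i +
      ∑ i ∈ Finset.range m, (p : ℤ[X]) ^ i • y i = ∑ i ∈ Finset.range m, (p : ℤ[X]) ^ i • δ i := by
    rw [← Finset.sum_add_distrib]
    refine Finset.sum_congr rfl fun i hi => ?_
    rw [← smul_add, (hxy i (Finset.mem_range.1 hi)).2.2]
  have h1 := h.eq_smul_sum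
  rw [← hσd] at h1
  have hmem : σd • α₁ - ∑ i ∈ Finset.range m, (p : ℤ[X]) ^ i • x i ∈ S ⊓ S' := by
    refine ⟨sub_mem (S.smul_mem _ hα₁) (sum_mem fun i hi =>
      S.smul_mem _ (hxy i (Finset.mem_range.1 hi)).1), ?_⟩
    have h2 : σd • α₁ - ∑ i ∈ Finset.range m, (p : ℤ[X]) ^ i • x i = (p : ℤ[X]) ^ m • δ m
        - (σd • α₂ - ∑ i ∈ Finset.range m, (p : ℤ[X]) ^ i • y i) := by
      linear_combination (norm := module) h1 + σd • hα - hsumxy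
    rw [h2]
    exact sub_mem (hPS' (smul_mem_mulSub _ _)) (sub_mem (S'.smul_mem _ hα₂)
      (sum_mem fun i hi => S'.smul_mem _ (hxy i (Finset.mem_range.1 hi)).2.1))
  rw [hinf] at hmem
  obtain ⟨κ, hκ⟩ := mem_mulSub.1 hmem
  set γ' : ℕ → A := fun i => if i < m then γ i else κ + ∑ i ∈ Finset.range m, v i with hγ'
  have hγ'lt : ∀ i < m, γ' i = γ i := fun i hi => if_pos hi
  have hγ'm : γ' m = κ + ∑ i ∈ Finset.range m, v i := if_neg (lt_irrefl _)
  have hxγ : ∑ i ∈ Finset.range m, (p : ℤ[X]) ^ i • x i =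
      ∑ i ∈ Finset.range m, (p : ℤ[X]) ^ i • γ' i +
        (p : ℤ[X]) ^ m • ∑ i ∈ Finset.range m, v i := by
    rw [Finset.smul_sum, ← Finset.sum_add_distrib]
    refine Finset.sum_congr rfl fun i hi => ?_
    have hi' := Finset.mem_range.1 hi
    have hmi : (p : ℤ[X]) ^ m = (p : ℤ[X]) ^ i * (p : ℤ[X]) ^ (m - i) := by
      rw [← pow_add, Nat.add_sub_cancel' hi'.le]
    rw [hγ'lt i hi', (hγv i hi').2, hmi]
    module
  set lam := (e : ℤ[X]) • trPoly p n • α₁ +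
    ∑ i ∈ Finset.range (m + 1), normPoly p n i • γ' i with hlam
  have hrep : IsRep p n m a e α₁ γ' lam := by
    refine ⟨fun i hi => ?_, ?_, rfl⟩
    · rw [hγ'lt i hi]; exact (hγv i hi).1
    · rw [Finset.sum_range_succ, hγ'm, ← hσd]
      linear_combination (norm := module) hκ + hxγ
  have hrep' : IsRep p n m a e (α - α₁) (fun i => δ i - γ' i) (ξ - lam) := by
    refine ⟨fun i hi => ?_, ?_, ?_⟩
    · rw [smul_sub, h.rep.level i hi, hrep.level i hi, sub_zero]
    · rw [smul_sub, h.rep.eq, hrep.eq, ← Finset.sum_sub_distrib]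
      exact Finset.sum_congr rfl fun i _ => (smul_sub _ _ _).symm
    · rw [← h.rep.norm, hlam]
      simp only [smul_sub, Finset.sum_sub_distrib]
      abel
  have hvp : ∀ i < m, (p : ℤ[X]) ^ (m - i) • v i ∈ mulSub A (p : ℤ[X]) := fun i hi =>
    smul_mem_mulSub_of_dvd (dvd_pow_self _ (by omega)) _
  by_cases h0 : lam = 0
  · left
    refine h.le_of_rep (S := S') (S' := S) (by rw [inf_comm, hinf]) (by rw [sup_comm, hsup])
      ⟨h.kummer.of_torsion (x := ξ - lam) ?_
        (hrep'.norm_torsion h.kummer.pos h.vec.pos h.vec.lt h.kummer.ann), h.vec, hrep'⟩ ?_ ?_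
    · rw [h0, sub_zero]; exact h.kummer.ne_zero
    · rw [← hα, add_sub_cancel_left]; exact hα₂
    · intro i hi
      obtain ⟨hxS, hyS, hsum⟩ := hxy i hi
      have h2 : δ i - γ' i = y i + (p : ℤ[X]) ^ (m - i) • v i := by
        rw [hγ'lt i hi]
        linear_combination (norm := module) -hsum + (hγv i hi).2
      rw [h2]
      exact add_mem (Submodule.mem_sup_left hyS) (Submodule.mem_sup_right (hvp i hi))
  · right
    refine h.le_of_rep hinf hsup
      ⟨h.kummer.of_torsion h0
        (hrep.norm_torsion h.kummer.pos h.vec.pos h.vec.lt h.kummer.ann), h.vec, hrep⟩ hα₁ ?_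
    intro i hi
    rw [hγ'lt i hi, show γ i = x i - (p : ℤ[X]) ^ (m - i) • v i by rw [(hγv i hi).2]; abel]
    exact sub_mem (Submodule.mem_sup_left (hxy i hi).1) (Submodule.mem_sup_right (hvp i hi))

lemma not_mem_mulSub : α ∉ mulSub A ((p : ℤ[X]) ^ m) := by
  intro hα
  obtain ⟨κ, hκ⟩ := mem_mulSub.1 hα
  have h1 := h.dvd_of_add_sum_mem (c := 1) (g := 0) (by
    simp only [Int.cast_one, one_smul, Pi.zero_apply, zero_smul, Finset.sum_const_zero, add_zero]
    rw [hκ]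
    exact smul_mem_mulSub_of_dvd (dvd_pow_self _ h.vec.pos.ne') _)
  exact h.kummer.prime.one_lt.ne' (by exact_mod_cast Int.eq_one_of_dvd_one (by positivity) h1)

end MinRep

end IndecomposabilityTheory

section Units

open Polynomial

variable {F K : Type*} [Field F] [Field K] [Algebra F K]

/-- The unit group of `K`, written additively, with `X` acting through `σ`. -/
abbrev GalUnits (σ : K ≃ₐ[F] K) : Type _ :=
  Module.AEval' (MonoidHom.toAdditive (umap σ)).toIntLinearMap

/-- The additive copy of a unit. -/
def gu (σ : K ≃ₐ[F] K) (x : Kˣ) : GalUnits σ := Module.AEval'.of _ (Additive.ofMul x)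

variable (σ : K ≃ₐ[F] K)

lemma gu_mul (x y : Kˣ) : gu σ (x * y) = gu σ x + gu σ y := by
  rw [gu, ofMul_mul, map_add]; rfl

lemma gu_one : gu σ 1 = 0 := by rw [gu, ofMul_one, map_zero]

lemma gu_inv (x : Kˣ) : gu σ x⁻¹ = -gu σ x := by
  rw [gu, ofMul_inv, map_neg]; rfl

lemma gu_injective : Function.Injective (gu σ) :=
  (Module.AEval'.of _).injective.comp Additive.ofMul.injective

lemma gu_surjective : Function.Surjective (gu σ) :=
  (Module.AEval'.of _).surjective.comp Additive.ofMul.surjective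

lemma gu_eq_zero {x : Kˣ} : gu σ x = 0 ↔ x = 1 := by
  rw [← gu_one σ, (gu_injective σ).eq_iff]

lemma gu_pow (x : Kˣ) (k : ℕ) : gu σ (x ^ k) = (k : ℤ[X]) • gu σ x := by
  rw [gu, ofMul_pow, map_nsmul, Nat.cast_smul_eq_nsmul]; rfl

lemma gu_zpow (x : Kˣ) (k : ℤ) : gu σ (x ^ k) = (k : ℤ[X]) • gu σ x := by
  rw [gu, ofMul_zpow, map_zsmul, Int.cast_smul_eq_zsmul]; rfl

lemma gu_prod {ι : Type*} (s : Finset ι) (f : ι → Kˣ) :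
    gu σ (∏ i ∈ s, f i) = ∑ i ∈ s, gu σ (f i) := by
  classical
  induction s using Finset.induction_on with
  | empty => simpa using gu_one σ
  | insert i s hi ih => rw [Finset.prod_insert hi, Finset.sum_insert hi, gu_mul, ih]

lemma gu_umap (x : Kˣ) : gu σ (umap σ x) = (X : ℤ[X]) • gu σ x :=
  (Module.AEval'.X_smul_of _ _).symm

lemma umap_mul (τ τ' : K ≃ₐ[F] K) (x : Kˣ) : umap (τ * τ') x = umap τ (umap τ' x) := rfl

lemma umap_one (x : Kˣ) : umap (1 : K ≃ₐ[F] K) x = x := rfl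

lemma gu_umap_pow (k : ℕ) (x : Kˣ) : gu σ (umap (σ ^ k) x) = (X : ℤ[X]) ^ k • gu σ x := by
  induction k generalizing x with
  | zero => simp [umap_one]
  | succ k ih => rw [pow_succ, pow_succ, umap_mul, ih, gu_umap, mul_smul]

lemma gu_normHom (p j : ℕ) (x : Kˣ) : gu σ (normHom p σ j x) = trPoly p j • gu σ x := by
  rw [normHom, MonoidHom.finsetProd_apply, gu_prod, trPoly, Finset.sum_smul]
  exact Finset.sum_congr rfl fun k _ => gu_umap_pow σ k x

lemma levelMem_iff (p : ℕ) (a : WithBot ℕ) (x : Kˣ) :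
    levelMem p σ a x ↔ annPoly p a • gu σ x = 0 := by
  induction a using WithBot.recBotCoe with
  | bot => rw [annPoly_bot, one_smul, gu_eq_zero]; rfl
  | coe s =>
    rw [annPoly_some, sub_smul, one_smul, sub_eq_zero, ← gu_umap_pow, (gu_injective σ).eq_iff]
    change x ∈ (umap (σ ^ p ^ s) / MonoidHom.id Kˣ).ker ↔ _
    rw [MonoidHom.mem_ker, MonoidHom.div_apply, div_eq_one, MonoidHom.id_apply]

lemma represents_iff {p n m : ℕ} (hp : p ≠ 0) (ξ : Kˣ) (a : ℕ → WithBot ℕ) (e : ℤ)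
    (α : Kˣ) (δ : ℕ → Kˣ) :
    Represents p n σ ξ (fun i : Fin m => a i) (1 + p * e) α δ ↔
      IsRep p n m a e (gu σ α) (fun i => gu σ (δ i)) (gu σ ξ) := by
  have hp' : (p : ℤ) ≠ 0 := by exact_mod_cast hp
  have h1 : (∀ i : Fin m, levelMem p σ (a i) (δ i)) ↔
      ∀ i < m, annPoly p (a i) • gu σ (δ i) = 0 := by
    simp only [levelMem_iff, Fin.forall_iff]
  have h2 : (umap σ α = α ^ (1 + p * e) * ∏ i ∈ Finset.range (m + 1), δ i ^ p ^ i) ↔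
      ((X : ℤ[X]) - (1 + (p : ℤ[X]) * (e : ℤ[X]))) • gu σ α =
        ∑ i ∈ Finset.range (m + 1), (p : ℤ[X]) ^ i • gu σ (δ i) := by
    rw [← (gu_injective σ).eq_iff, gu_umap, gu_mul, gu_zpow, gu_prod, sub_smul, sub_eq_iff_eq_add']
    simp only [gu_pow]
    push_cast
    rfl
  have h3 : (ξ = normHom p σ n α ^ ((1 + p * e - 1) / (p : ℤ)) * normHom p σ (n - 1) (δ 0) *
      ∏ i ∈ Finset.Icc 1 m, normHom p σ n (δ i) ^ p ^ (i - 1)) ↔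
      (e : ℤ[X]) • trPoly p n • gu σ α +
        ∑ i ∈ Finset.range (m + 1), normPoly p n i • gu σ (δ i) = gu σ ξ := by
    rw [add_sub_cancel_left, Int.mul_ediv_cancel_left _ hp', ← (gu_injective σ).eq_iff, gu_mul,
      gu_mul, gu_zpow, gu_prod, gu_normHom, gu_normHom, Finset.sum_range_succ', normPoly_zero,
      ← Finset.Ico_succ_right_eq_Icc, Finset.sum_Ico_eq_sum_range]
    simp only [gu_pow, gu_normHom, Nat.succ_eq_succ, Nat.succ_eq_add_one, Nat.add_sub_cancel,
      normPoly_succ, mul_smul, Nat.cast_pow, Nat.add_comm 1]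
    rw [eq_comm, add_assoc, add_comm (trPoly p (n - 1) • _)]
  exact (and_congr h1 (and_congr h2 h3)).trans
    ⟨fun h => ⟨h.1, h.2.1, h.2.2⟩, fun h => ⟨h.level, h.eq, h.norm⟩⟩

/-- Hilbert's theorem 90 for the cyclic group generated by `τ`. -/
lemma exists_eq_div_of_prod_eq_one (τ : K ≃ₐ[F] K) {N : ℕ} (hN : orderOf τ = N) (hN0 : 0 < N)
    (x : Kˣ) (hx : ∏ k ∈ Finset.range N, umap (τ ^ k) x = 1) : ∃ y : Kˣ, x = umap τ y / y := by
  set c : ℕ → Kˣ := fun k => ∏ l ∈ Finset.range k, umap (τ ^ l) x with hc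
  have hcs : ∀ k, umap τ (c k) * x = c (k + 1) := fun k => by
    rw [hc]
    simp only [map_prod]
    rw [Finset.prod_range_succ']
    congr 1
    exact Finset.prod_congr rfl fun l _ => by rw [pow_succ', umap_mul]
  have hinj : Function.Injective (fun k : Fin N => ((τ ^ (k : ℕ) : K ≃ₐ[F] K) : K →* K)) := by
    intro i j hij
    have h1 : τ ^ (i : ℕ) = τ ^ (j : ℕ) := by
      ext z
      exact DFunLike.congr_fun hij z
    exact Fin.ext (pow_injOn_Iio_orderOf (by simp [hN]) (by simp [hN]) h1)
  have hli := (linearIndependent_monoidHom K K).comp _ hinj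
  obtain ⟨θ, hθ⟩ : ∃ θ : K, ∑ k ∈ Finset.range N, (c k : K) * (τ ^ k) θ ≠ 0 := by
    by_contra! hcon
    have h1 := Fintype.linearIndependent_iff.1 hli (fun k => (c k : K)) (by
      ext θ
      rw [Finset.sum_apply, Pi.zero_apply, ← hcon θ, Finset.sum_range]
      rfl) ⟨0, hN0⟩
    exact (c 0).ne_zero h1
  set b := ∑ k ∈ Finset.range N, (c k : K) * (τ ^ k) θ with hb
  have hτb : τ b * x = b := by
    have h2 : τ b * x = ∑ k ∈ Finset.range N, (c (k + 1) : K) * (τ ^ (k + 1)) θ := by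
      rw [hb, map_sum, Finset.sum_mul]
      refine Finset.sum_congr rfl fun k _ => ?_
      rw [← hcs, map_mul, pow_succ', Units.val_mul]
      change τ (c k : K) * _ * _ = τ (c k : K) * x * τ ((τ ^ k) θ)
      ring
    have h3 := Finset.sum_range_succ (fun k => (c k : K) * (τ ^ k) θ) N
    rw [Finset.sum_range_succ'] at h3
    have h4 : c N = c 0 := by rw [hc]; simpa using hx
    rw [← h2, h4, ← hN, pow_orderOf_eq_one, pow_zero] at h3
    simpa [hN, hb] using h3
  refine ⟨(Units.mk0 b hθ)⁻¹, ?_⟩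
  rw [map_inv, div_inv_eq_mul, eq_inv_mul_iff_mul_eq]
  ext
  exact hτb

lemma cyclicKummer {p n : ℕ} (hp : p.Prime) (hn : 0 < n) (horder : orderOf σ = p ^ n)
    {ξ : Kˣ} (hξ : IsPrimitiveRoot (ξ : K) p) (hξF : (ξ : K) ∈ Set.range (algebraMap F K))
    (hspecial : p = 2 → n = 1 → ∃ γ : Kˣ, normHom p σ n γ = -1) :
    CyclicKummer p n (GalUnits σ) (gu σ ξ) where
  prime := hp
  pos := hn
  ann x := by
    obtain ⟨x, rfl⟩ := gu_surjective σ x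
    rw [sub_smul, one_smul, sub_eq_zero, ← gu_umap_pow, ← horder, pow_orderOf_eq_one, umap_one]
  hilbert j hj x hx := by
    obtain ⟨x, rfl⟩ := gu_surjective σ x
    have hτ : orderOf (σ ^ p ^ j) = p ^ (n - j) := by
      rw [orderOf_pow_of_dvd (pow_ne_zero _ hp.ne_zero) (horder ▸ pow_dvd_pow p hj), horder,
        Nat.pow_div hj hp.pos]
    obtain ⟨y, hy⟩ := exists_eq_div_of_prod_eq_one (σ ^ p ^ j) hτ (pow_pos hp.pos _) x (by
      rw [← gu_eq_zero σ, gu_prod, ← hx, relPoly, Finset.sum_smul]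
      refine Finset.sum_congr rfl fun k _ => ?_
      rw [← pow_mul, gu_umap_pow, ← pow_mul])
    refine ⟨gu σ y, ?_⟩
    rw [hy, div_eq_mul_inv, gu_mul, gu_inv, gu_umap_pow, sub_smul, one_smul, sub_eq_add_neg]
  ne_zero h := by
    have h1 : (ξ : K) = 1 := by rw [(gu_eq_zero σ).1 h, Units.val_one]
    exact hξ.ne_one hp.one_lt h1
  smul_eq_zero := by
    rw [← gu_pow, gu_eq_zero]
    ext
    rw [Units.val_pow_eq_pow_val, hξ.pow_eq_one, Units.val_one]
  fixed := by
    rw [sub_smul, one_smul, sub_eq_zero, ← gu_umap]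
    congr 1
    ext
    obtain ⟨z, hz⟩ := hξF
    change σ (ξ : K) = ξ
    rw [← hz, AlgEquiv.commutes]
  torsion x hx := by
    obtain ⟨x, rfl⟩ := gu_surjective σ x
    rw [← gu_pow, gu_eq_zero] at hx
    have : NeZero p := ⟨hp.ne_zero⟩
    obtain ⟨i, -, hi⟩ := hξ.eq_pow_of_pow_eq_one (ξ := (x : K)) (by
      rw [← Units.val_pow_eq_pow_val, hx, Units.val_one])
    refine ⟨i, ?_⟩
    rw [← gu_zpow, zpow_natCast]
    congr 1
    ext
    rw [Units.val_pow_eq_pow_val, hi]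
  special h2 h1 := by
    obtain ⟨γ, hγ⟩ := hspecial h2 h1
    refine ⟨gu σ γ, ?_⟩
    rw [← gu_normHom, hγ]
    congr 1
    ext
    subst h2
    rw [Units.val_neg, Units.val_one, hξ.eq_neg_one_of_two_right]

lemma isMinVec {p n m : ℕ} {ξ : Kˣ} (hm : 0 < m) (hK : CyclicKummer p n (GalUnits σ) (gu σ ξ))
    {a : ℕ → WithBot ℕ} {d : ℤ}
    (hmin : IsMinimalNormPair p n σ ξ (fun i : Fin m => a i) d) :
    IsMinVec p n m (GalUnits σ) a where
  pos := hm
  le i hi := hmin.1.1 ⟨i, hi⟩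
  lt := hmin.1.2.1 hm
  min k hk a' hle hlt heq hak e α δ lam r := by
    by_contra hlam
    obtain ⟨c, rfl⟩ := hK.torsion lam (r.norm_torsion hK.pos hm hlt hK.ann)
    have hc : ¬ (p : ℤ) ∣ c := by
      rintro ⟨c', rfl⟩
      apply hlam
      push_cast
      rw [mul_comm, mul_smul, hK.smul_eq_zero, smul_zero]
    obtain ⟨s, t, hst⟩ := (Int.isCoprime_iff_gcd_eq_one.2
      ((Nat.Prime.coprime_iff_not_dvd hK.prime).2 (fun h => hc (Int.natCast_dvd.2 h))) :
        IsCoprime (p : ℤ) c)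
    have hst' : (s : ℤ[X]) * (p : ℤ[X]) + (t : ℤ[X]) * (c : ℤ[X]) = 1 := by exact_mod_cast hst
    have r' : IsRep p n m a' e ((t : ℤ[X]) • α) (fun i => (t : ℤ[X]) • δ i) (gu σ ξ) := by
      refine ⟨fun i hi => ?_, ?_, ?_⟩
      · rw [smul_comm, r.level i hi, smul_zero]
      · rw [smul_comm, r.eq, Finset.smul_sum]
        exact Finset.sum_congr rfl fun i _ => smul_comm _ _ _
      · have h1 : (t : ℤ[X]) • ∑ i ∈ Finset.range (m + 1), normPoly p n i • δ i =
            ∑ i ∈ Finset.range (m + 1), normPoly p n i • (t : ℤ[X]) • δ i := by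
          rw [Finset.smul_sum]
          exact Finset.sum_congr rfl fun i _ => smul_comm _ _ _
        linear_combination (norm := module) (t : ℤ[X]) • r.norm - h1 + hst' • gu σ ξ
          - (s : ℤ[X]) • hK.smul_eq_zero
    obtain ⟨β, hβ⟩ := gu_surjective σ ((t : ℤ[X]) • α)
    choose ε hε using fun i => gu_surjective σ ((t : ℤ[X]) • δ i)
    have hr := (represents_iff σ (m := m) hK.prime.ne_zero ξ a' e β ε).2 (by
      rw [hβ]; simp only [hε]; exact r')
    have hpair := hmin.2 (fun i : Fin m => a' i) (1 + p * e)
      ⟨fun i => hle i i.2, fun _ => hlt, ⟨e, by ring⟩, β, ε, hr⟩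
    rcases hpair with ⟨l, hl, hl'⟩ | ⟨h, -⟩
    · simp only at hl hl'
      rcases lt_trichotomy (l : ℕ) k with h1 | h1 | h1
      · rw [heq _ h1] at hl'; exact lt_irrefl _ hl'
      · rw [h1] at hl'; exact lt_asymm hl' hak
      · have := hl ⟨k, hk⟩ h1
        simp only at this
        rw [this] at hak
        exact lt_irrefl _ hak
    · have := congrFun h ⟨k, hk⟩
      simp only at this
      rw [this] at hak
      exact lt_irrefl _ hak

end Units

section GroupRing

open Polynomial

/-- The ring homomorphism from polynomials to the group ring sending `X` to the generator. -/
noncomputable def evalGen (p m n : ℕ) : ℤ[X] →+* CycGR p m n :=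
  (aeval (R := ℤ) (gen p m n)).toRingHom

@[simp] lemma evalGen_X (p m n : ℕ) : evalGen p m n X = gen p m n := aeval_X _

lemma gen_pow (p m n k : ℕ) : gen p m n ^ k =
    MonoidAlgebra.of (ZMod (p ^ m)) _ (Multiplicative.ofAdd (k : ZMod (p ^ n))) := by
  rw [gen, ← map_pow, ← ofAdd_nsmul, nsmul_one]

lemma gen_pow_order (p m n : ℕ) : gen p m n ^ p ^ n = 1 := by
  rw [gen_pow, ZMod.natCast_self, ofAdd_zero, map_one]

lemma natCast_pow_eq_zero (p m n : ℕ) : (p : CycGR p m n) ^ m = 0 := by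
  have h : ((p ^ m : ℕ) : CycGR p m n) = 0 := by
    rw [← map_natCast (algebraMap (ZMod (p ^ m)) (CycGR p m n)), ZMod.natCast_self, map_zero]
  exact_mod_cast h

lemma evalGen_surjective {p : ℕ} (hp : p.Prime) (m n : ℕ) :
    Function.Surjective (evalGen p m n) := by
  have : NeZero (p ^ n) := ⟨(pow_pos hp.pos n).ne'⟩
  intro x
  induction x using MonoidAlgebra.induction_on with
  | of g =>
    refine ⟨X ^ (Multiplicative.toAdd g).val, ?_⟩
    rw [map_pow, evalGen_X, gen_pow, ZMod.natCast_zmod_val]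
    rfl
  | add x y hx hy =>
    obtain ⟨f, rfl⟩ := hx
    obtain ⟨g, rfl⟩ := hy
    exact ⟨f + g, map_add _ _ _⟩
  | smul r x hx =>
    obtain ⟨f, rfl⟩ := hx
    obtain ⟨c, rfl⟩ := ZMod.intCast_surjective r
    exact ⟨(c : ℤ[X]) * f, by
      rw [map_mul, map_intCast, Algebra.smul_def, map_intCast]⟩

lemma eq_of_evalGen_eq_zero {p : ℕ} (hp : p.Prime) (m n : ℕ) {f : ℤ[X]}
    (hf : evalGen p m n f = 0) :
    ∃ q s : ℤ[X], f = (X ^ p ^ n - 1) * q + (p : ℤ[X]) ^ m * s := by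
  set P : ℤ[X] := X ^ p ^ n - 1 with hP
  have hPm : P.Monic := monic_X_pow_sub_one hp n
  set r := f %ₘ P with hr
  have hdiv : r + P * (f /ₘ P) = f := modByMonic_add_div f P
  have hdeg : r.natDegree < p ^ n := by
    have h1 : P.natDegree = p ^ n := by
      rw [hP, show (1 : ℤ[X]) = C 1 by simp]
      exact natDegree_X_pow_sub_C
    rw [← h1]
    exact natDegree_modByMonic_lt f hPm (fun h => by
      rw [h] at h1; simp at h1; exact absurd h1 (pow_pos hp.pos n).ne)
  have hr0 : evalGen p m n r = 0 := by
    rw [← hdiv, map_add, map_mul, hP, map_sub, map_pow, evalGen_X, gen_pow_order, map_one,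
      sub_self, zero_mul, add_zero] at hf
    exact hf
  have hsum : ∑ k ∈ Finset.range (p ^ n), MonoidAlgebra.single
      (Multiplicative.ofAdd (k : ZMod (p ^ n))) ((r.coeff k : ℤ) : ZMod (p ^ m)) = 0 := by
    rw [← hr0, r.as_sum_range' _ hdeg, map_sum]
    refine Finset.sum_congr rfl fun k hk => ?_
    rw [← r.as_sum_range' _ hdeg, ← C_mul_X_pow_eq_monomial, map_mul, map_pow, evalGen_X, gen_pow,
      show (C (r.coeff k) : ℤ[X]) = ((r.coeff k : ℤ) : ℤ[X]) by simp, map_intCast,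
      ← map_intCast (algebraMap (ZMod (p ^ m)) (CycGR p m n)), ← Algebra.smul_def,
      MonoidAlgebra.of_apply, MonoidAlgebra.smul_single, smul_eq_mul, mul_one]
  have hdvd : C ((p : ℤ) ^ m) ∣ r := by
    rw [C_dvd_iff_dvd_coeff]
    intro k
    by_cases hk : k < p ^ n
    · have h1 := congrArg
        (fun x : CycGR p m n => x.coeff (Multiplicative.ofAdd (k : ZMod (p ^ n)))) hsum
      simp only [MonoidAlgebra.coeff_sum, Finsupp.finsetSum_apply, MonoidAlgebra.coeff_zero] at h1
      rw [Finset.sum_eq_single_of_mem k (Finset.mem_range.2 hk)] at h1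
      · rw [MonoidAlgebra.coeff_single, Finsupp.single_eq_same, Finsupp.zero_apply] at h1
        exact_mod_cast (ZMod.intCast_zmod_eq_zero_iff_dvd _ _).1 h1
      · intro l hl hlk
        rw [MonoidAlgebra.coeff_single, Finsupp.single_eq_of_ne]
        intro h
        apply hlk
        have h2 := (ZMod.natCast_eq_natCast_iff' _ _ _).1 (Multiplicative.ofAdd.injective h.symm)
        rwa [Nat.mod_eq_of_lt (Finset.mem_range.1 hl), Nat.mod_eq_of_lt hk] at h2
    · rw [coeff_eq_zero_of_natDegree_lt (by omega)]
      exact dvd_zero _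
  obtain ⟨s, hs⟩ := hdvd
  refine ⟨f /ₘ P, s, ?_⟩
  have h5 : (C ((p : ℤ) ^ m) : ℤ[X]) = (p : ℤ[X]) ^ m := by simp
  rw [h5] at hs
  linear_combination -hdiv + hs

variable {A : Type*} [AddCommGroup A] [Module ℤ[X] A]

/-- The linear combinations of `α, δ 0, …, δ (m - 1)`, with coefficients indexed by
`Fin (m + 1)`. -/
noncomputable def finComb (m : ℕ) (α : A) (δ : ℕ → A) : (Fin (m + 1) → ℤ[X]) →ₗ[ℤ[X]] A :=
  Fintype.linearCombination ℤ[X] (Fin.cons α (fun i : Fin m => δ i) : Fin (m + 1) → A)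

lemma finComb_apply (m : ℕ) (α : A) (δ : ℕ → A) (v : Fin (m + 1) → ℤ[X]) :
    finComb m α δ v = v 0 • α + ∑ i : Fin m, v i.succ • δ i := by
  rw [finComb, Fintype.linearCombination_apply, Fin.sum_univ_succ]
  rfl

lemma comb_eq_finComb (m : ℕ) (α : A) (δ : ℕ → A) (u : ℤ[X]) (g : ℕ → ℤ[X]) :
    comb m α δ (u, g) = finComb m α δ (Fin.cons u fun i => g i) := by
  rw [comb_apply, finComb_apply, Finset.sum_range]
  rfl

lemma finComb_eq_comb (m : ℕ) (α : A) (δ : ℕ → A) (v : Fin (m + 1) → ℤ[X]) :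
    ∃ g : ℕ → ℤ[X], (∀ i : Fin m, g i = v i.succ) ∧ finComb m α δ v = comb m α δ (v 0, g) := by
  refine ⟨fun i => if hi : i < m then v (Fin.succ ⟨i, hi⟩) else 0, fun i => by simp, ?_⟩
  rw [comb_apply, finComb_apply, Finset.sum_range]
  simp

/-- Reduction of coefficient vectors to the group ring. -/
noncomputable def evalVec (p m n : ℕ) : (Fin (m + 1) → ℤ[X]) →+ (Fin (m + 1) → CycGR p m n) where
  toFun v j := evalGen p m n (v j)
  map_zero' := by ext1; simp
  map_add' v w := by ext1; simp

lemma evalVec_apply (p m n : ℕ) (v : Fin (m + 1) → ℤ[X]) (j : Fin (m + 1)) :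
    evalVec p m n v j = evalGen p m n (v j) := rfl

lemma evalVec_smul (p m n : ℕ) (f : ℤ[X]) (v : Fin (m + 1) → ℤ[X]) :
    evalVec p m n (f • v) = evalGen p m n f • evalVec p m n v := by
  ext1 j
  simp [evalVec_apply]

lemma evalVec_single (p m n : ℕ) (j : Fin (m + 1)) (f : ℤ[X]) :
    evalVec p m n (Pi.single j f) = sing p n m j (evalGen p m n f) := by
  ext1 k
  rw [evalVec_apply, sing, Pi.apply_single (fun _ => evalGen p m n) (fun _ => map_zero _)]

lemma evalVec_surjective {p : ℕ} (hp : p.Prime) (m n : ℕ) :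
    Function.Surjective (evalVec p m n) := by
  intro x
  choose v hv using fun j => evalGen_surjective hp m n (x j)
  exact ⟨v, funext hv⟩

lemma evalGen_annPoly (p m n : ℕ) (a : WithBot ℕ) : evalGen p m n (annPoly p a) =
    WithBot.recBotCoe (1 : CycGR p m n) (fun k => gen p m n ^ p ^ k - 1) a := by
  induction a using WithBot.recBotCoe with
  | bot => exact map_one _
  | coe s => rw [annPoly_some, map_sub, map_pow, evalGen_X, map_one]; rfl

/-- The coefficient vector of the relation `(σ - d) y = ∑ p ^ i x_i`. -/
noncomputable def relVec (p m : ℕ) (e : ℤ) : Fin (m + 1) → ℤ[X] :=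
  Fin.cons (X - (1 + (p : ℤ[X]) * (e : ℤ[X]))) fun i => -(p : ℤ[X]) ^ (i : ℕ)

lemma evalVec_relVec (p m n : ℕ) (e : ℤ) : evalVec p m n (relVec p m e) =
    sing p n m 0 (gen p m n - (((1 + p * e : ℤ) : ZMod (p ^ m)) • 1)) -
      ∑ i : Fin m, sing p n m i.succ ((p : CycGR p m n) ^ (i : ℕ)) := by
  ext1 j
  rw [evalVec_apply, Pi.sub_apply, Finset.sum_apply]
  refine Fin.cases ?_ (fun i => ?_) j
  · have h0 : ∀ i : Fin m, sing p n m i.succ ((p : CycGR p m n) ^ (i : ℕ)) 0 = 0 := fun i =>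
      Pi.single_eq_of_ne (Fin.succ_ne_zero i).symm _
    rw [Finset.sum_eq_zero fun i _ => h0 i, sub_zero, sing, Pi.single_eq_same, relVec,
      Fin.cons_zero, map_sub, evalGen_X, Algebra.smul_def, mul_one, map_intCast]
    simp
  · rw [Finset.sum_eq_single_of_mem i (Finset.mem_univ i), sing, sing, Pi.single_eq_same,
      Pi.single_eq_of_ne (Fin.succ_ne_zero i), zero_sub, relVec, Fin.cons_succ]
    · simp
    · intro k _ hk
      exact Pi.single_eq_of_ne (fun h => hk (Fin.succ_injective _ h).symm) _

namespace MinRep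

variable {p n m : ℕ} {a : ℕ → WithBot ℕ} {e : ℤ} {α : A} {δ : ℕ → A} {ξ : A}
  (h : MinRep p n m a e α δ ξ)
include h

lemma smul_mem_mulSub_of_evalGen_eq_zero {f : ℤ[X]} (hf : evalGen p m n f = 0) (x : A) :
    f • x ∈ mulSub A ((p : ℤ[X]) ^ m) := by
  obtain ⟨q, s, rfl⟩ := eq_of_evalGen_eq_zero h.kummer.prime m n hf
  rw [add_smul, mul_comm, mul_smul, h.kummer.ann, smul_zero, zero_add, mul_smul]
  exact smul_mem_mulSub _ _

lemma finComb_relVec : finComb m α δ (relVec p m e) = (p : ℤ[X]) ^ m • δ m := by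
  have h1 := h.eq_smul_sum
  have h2 : comb m α δ (X - (1 + (p : ℤ[X]) * (e : ℤ[X])), fun i => -(p : ℤ[X]) ^ i) =
      finComb m α δ (relVec p m e) := comb_eq_finComb _ _ _ _ _
  rw [← h2, comb_apply]
  simp only [neg_smul, Finset.sum_neg_distrib]
  linear_combination (norm := module) h1

/-- The defining relations of `Xadm` describe the relations between the generators of an
exceptional module. -/
lemma evalVec_mem_span_iff (v : Fin (m + 1) → ℤ[X]) :
    evalVec p m n v ∈ Submodule.span (CycGR p m n)
      (XRels p n m (fun i : Fin m => a i) (1 + p * e)) ↔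
    finComb m α δ v ∈ mulSub A ((p : ℤ[X]) ^ m) := by
  constructor
  · intro hv
    let T : Submodule (CycGR p m n) (Fin (m + 1) → CycGR p m n) :=
      { carrier := {x | ∃ w, finComb m α δ w ∈ mulSub A ((p : ℤ[X]) ^ m) ∧ evalVec p m n w = x}
        zero_mem' := ⟨0, by rw [map_zero]; exact zero_mem _, map_zero _⟩
        add_mem' := by
          rintro _ _ ⟨w, hw, rfl⟩ ⟨w', hw', rfl⟩
          exact ⟨w + w', by rw [map_add]; exact add_mem hw hw', map_add _ _ _⟩
        smul_mem' := by
          rintro c _ ⟨w, hw, rfl⟩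
          obtain ⟨f, rfl⟩ := evalGen_surjective h.kummer.prime m n c
          exact ⟨f • w, by rw [map_smul]; exact Submodule.smul_mem _ _ hw, evalVec_smul _ _ _ _ _⟩ }
    have hT : Submodule.span (CycGR p m n)
        (XRels p n m (fun i : Fin m => a i) (1 + p * e)) ≤ T := by
      rw [Submodule.span_le]
      rintro _ (rfl | ⟨i, rfl⟩)
      · exact ⟨relVec p m e, h.finComb_relVec ▸ smul_mem_mulSub _ _, evalVec_relVec _ _ _ _⟩
      · refine ⟨Pi.single i.succ (annPoly p (a i)), ?_, ?_⟩
        · rw [finComb, Fintype.linearCombination_apply_single, Fin.cons_succ,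
            h.rep.level i i.2]
          exact zero_mem _
        · rw [evalVec_single, evalGen_annPoly]
    obtain ⟨w, hw, hwv⟩ := hT hv
    have h1 : finComb m α δ (v - w) ∈ mulSub A ((p : ℤ[X]) ^ m) := by
      have h2 : ∀ j, evalGen p m n ((v - w) j) = 0 := fun j => by
        rw [← evalVec_apply, map_sub, hwv, sub_self]; rfl
      rw [finComb_apply]
      exact add_mem (h.smul_mem_mulSub_of_evalGen_eq_zero (h2 _) _)
        (sum_mem fun i _ => h.smul_mem_mulSub_of_evalGen_eq_zero (h2 _) _)
    have h3 := add_mem h1 hw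
    rwa [← map_add, sub_add_cancel] at h3
  · intro hv
    obtain ⟨g, hg, hvg⟩ := finComb_eq_comb m α δ v
    rw [hvg] at hv
    obtain ⟨q, w, D, B, W, hu, hgB⟩ := h.relation_mod_pow m le_rfl (u := v 0) (g := g) hv
    have hv' : evalVec p m n v = evalGen p m n q • evalVec p m n (relVec p m e) +
        ∑ i : Fin m, evalGen p m n (B i) • sing p n m i.succ (evalGen p m n (annPoly p (a i))) := by
      ext1 j
      rw [Pi.add_apply, Finset.sum_apply, Pi.smul_apply, evalVec_apply, evalVec_apply, smul_eq_mul,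
        ← map_mul]
      refine Fin.cases ?_ (fun i => ?_) j
      · rw [Finset.sum_eq_zero, add_zero, hu, relVec, Fin.cons_zero, map_add, map_add,
          map_mul _ (_ ^ m), map_pow, map_natCast, natCast_pow_eq_zero, zero_mul, add_zero,
          map_mul _ (_ - 1), map_sub, map_pow, evalGen_X, gen_pow_order, map_one, sub_self,
          zero_mul, add_zero]
        intro i _
        rw [Pi.smul_apply, sing, Pi.single_eq_of_ne (Fin.succ_ne_zero i).symm, smul_zero]
      · rw [Finset.sum_eq_single_of_mem i (Finset.mem_univ i), Pi.smul_apply, sing,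
          Pi.single_eq_same, ← hg, hgB i i.2, relVec, Fin.cons_succ, map_add, map_add,
          map_mul _ (_ ^ m), map_pow, map_natCast, natCast_pow_eq_zero, zero_mul, add_zero,
          smul_eq_mul, mul_comm (annPoly p (a i)), map_mul _ (B i), neg_mul, mul_neg]
        intro k _ hk
        rw [Pi.smul_apply, sing, Pi.single_eq_of_ne (fun h => hk (Fin.succ_injective _ h).symm),
          smul_zero]
    rw [hv']
    refine add_mem
      (Submodule.smul_mem _ _ (Submodule.subset_span (Or.inl (evalVec_relVec _ _ _ _))))
      (sum_mem fun i _ => Submodule.smul_mem _ _ (Submodule.subset_span (Or.inr ⟨i, ?_⟩)))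
    rw [evalGen_annPoly]

/-- The presentation of an exceptional module. -/
lemma exists_hom_of_ker {B : Type*} [AddCommGroup B] (π : A →+ B)
    (hπ : ∀ x, π x = 0 ↔ x ∈ mulSub A ((p : ℤ[X]) ^ m)) :
    ∃ φ : Xadm p n m (fun i : Fin m => a i) (1 + p * e) →+ B, Function.Injective φ ∧
      ∀ v, φ (Submodule.Quotient.mk (evalVec p m n v)) = π (finComb m α δ v) := by
  set R := Submodule.span (CycGR p m n) (XRels p n m (fun i : Fin m => a i) (1 + p * e)) with hR
  let Q : (Fin (m + 1) → ℤ[X]) →+ Xadm p n m (fun i : Fin m => a i) (1 + p * e) :=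
    R.mkQ.toAddMonoidHom.comp (evalVec p m n)
  have hQ : Function.Surjective Q :=
    R.mkQ_surjective.comp (evalVec_surjective h.kummer.prime m n)
  let Ψ : (Fin (m + 1) → ℤ[X]) →+ B := π.comp (finComb m α δ).toAddMonoidHom
  have hker : ∀ v, Q v = 0 ↔ Ψ v = 0 := fun v =>
    (Submodule.Quotient.mk_eq_zero R).trans ((h.evalVec_mem_span_iff v).trans (hπ _).symm)
  let φ := AddMonoidHom.liftOfSurjective Q hQ ⟨Ψ, fun v hv => (hker v).1 hv⟩
  have hφ : ∀ v, φ (Q v) = Ψ v := fun v =>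
    AddMonoidHom.liftOfRightInverse_comp_apply Q _ (Function.rightInverse_surjInv hQ) _ v
  refine ⟨φ, (injective_iff_map_eq_zero φ).2 fun x hx => ?_, hφ⟩
  obtain ⟨v, rfl⟩ := hQ x
  rw [hφ] at hx
  exact (hker v).2 hx

end MinRep

end GroupRing

section Exceptional

open Polynomial

variable {F K : Type*} [Field F] [Field K] [Algebra F K] (σ : K ≃ₐ[F] K)

/-- The projection from the unit group of `K` to its quotient by `q`-th powers. -/
noncomputable def toJ (q : ℕ) : GalUnits σ →+ Additive (Kˣ ⧸ powSub K q) :=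
  (MonoidHom.toAdditive (QuotientGroup.mk' (powSub K q))).comp
    (Module.AEval'.of (MonoidHom.toAdditive (umap σ)).toIntLinearMap).symm.toAddMonoidHom

lemma toJ_gu (q : ℕ) (x : Kˣ) : toJ σ q (gu σ x) = Additive.ofMul (jcls q x) := rfl

lemma toJ_surjective (q : ℕ) : Function.Surjective (toJ σ q) := by
  intro y
  obtain ⟨x, hx⟩ := QuotientGroup.mk_surjective (Additive.toMul y)
  exact ⟨gu σ x, (toJ_gu σ q x).trans (congrArg Additive.ofMul hx)⟩

lemma toJ_X_smul (q : ℕ) (x : GalUnits σ) :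
    toJ σ q ((X : ℤ[X]) • x) = Additive.ofMul (jmap q σ (Additive.toMul (toJ σ q x))) := by
  obtain ⟨x, rfl⟩ := gu_surjective σ x
  rw [← gu_umap, toJ_gu, toJ_gu]
  rfl

lemma toJ_eq_zero (q : ℕ) (x : GalUnits σ) :
    toJ σ q x = 0 ↔ x ∈ mulSub (GalUnits σ) (q : ℤ[X]) := by
  obtain ⟨x, rfl⟩ := gu_surjective σ x
  rw [toJ_gu, ofMul_eq_zero, jcls, QuotientGroup.eq_one_iff, mem_mulSub]
  constructor
  · rintro ⟨y, rfl⟩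
    exact ⟨gu σ y, gu_pow σ y q⟩
  · rintro ⟨y, hy⟩
    obtain ⟨y, rfl⟩ := gu_surjective σ y
    rw [← gu_pow] at hy
    exact ⟨y, (gu_injective σ hy).symm⟩

lemma toJ_eq_toJ_iff (q : ℕ) (x y : GalUnits σ) :
    toJ σ q x = toJ σ q y ↔ x - y ∈ mulSub (GalUnits σ) (q : ℤ[X]) := by
  rw [← toJ_eq_zero]
  constructor
  · intro h
    rw [sub_eq_add_neg, map_add, h, ← map_add, add_neg_cancel, map_zero]
  · intro h
    rw [← sub_add_cancel x y, map_add, h, ← map_zero (toJ σ q), ← map_add, zero_add]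

lemma exists_toJ_eq_of_mem_closure {q : ℕ} {S : Set (Kˣ ⧸ powSub K q)}
    {M : Submodule ℤ[X] (GalUnits σ)} (h : ∀ y ∈ S, ∃ z ∈ M, toJ σ q z = Additive.ofMul y)
    {y : Kˣ ⧸ powSub K q} (hy : y ∈ Subgroup.closure S) :
    ∃ z ∈ M, toJ σ q z = Additive.ofMul y := by
  induction hy using Subgroup.closure_induction with
  | mem y hy => exact h y hy
  | one => exact ⟨0, zero_mem _, by rw [map_zero, ofMul_one]⟩
  | mul x y _ _ hx hy =>
    obtain ⟨z, hz, hzx⟩ := hx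
    obtain ⟨w, hw, hwy⟩ := hy
    exact ⟨z + w, add_mem hz hw, by rw [map_add, hzx, hwy, ofMul_mul]⟩
  | inv x _ hx =>
    obtain ⟨z, hz, hzx⟩ := hx
    exact ⟨-z, neg_mem hz, by rw [map_neg, hzx, ofMul_inv]⟩

/-- The preimage of a `σ`-stable subgroup of `K^× / (K^×)^q`. -/
noncomputable def pullback (q : ℕ) (S : Subgroup (Kˣ ⧸ powSub K q))
    (hS : ∀ x ∈ S, jmap q σ x ∈ S) : Submodule ℤ[X] (GalUnits σ) where
  carrier := {x | Additive.toMul (toJ σ q x) ∈ S}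
  zero_mem' := by
    change Additive.toMul (toJ σ q 0) ∈ S
    rw [map_zero, toMul_zero]
    exact one_mem _
  add_mem' {x y} hx hy := by
    change Additive.toMul (toJ σ q (x + y)) ∈ S
    rw [map_add, toMul_add]
    exact mul_mem hx hy
  smul_mem' f x hx := by
    change Additive.toMul (toJ σ q (f • x)) ∈ S
    induction f using Polynomial.induction_on' with
    | add f g hf hg =>
      rw [add_smul, map_add, toMul_add]
      exact mul_mem hf hg
    | monomial k c =>
      have hX : ∀ k : ℕ, Additive.toMul (toJ σ q ((X : ℤ[X]) ^ k • x)) ∈ S := fun k => by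
        induction k with
        | zero => rw [pow_zero, one_smul]; exact hx
        | succ k ih =>
          rw [pow_succ', mul_smul, toJ_X_smul]
          exact hS _ ih
      rw [← C_mul_X_pow_eq_monomial, show (C c : ℤ[X]) = (c : ℤ[X]) by simp, mul_smul,
        Int.cast_smul_eq_zsmul, map_zsmul, toMul_zsmul]
      exact zpow_mem (hX k) c

lemma mem_pullback {q : ℕ} {S : Subgroup (Kˣ ⧸ powSub K q)} {hS : ∀ x ∈ S, jmap q σ x ∈ S}
    {x : GalUnits σ} : x ∈ pullback σ q S hS ↔ Additive.toMul (toJ σ q x) ∈ S := Iff.rfl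

lemma mulSub_le_pullback {q : ℕ} {S : Subgroup (Kˣ ⧸ powSub K q)} (hS : ∀ x ∈ S, jmap q σ x ∈ S) :
    mulSub (GalUnits σ) (q : ℤ[X]) ≤ pullback σ q S hS := fun x hx => by
  rw [mem_pullback, (toJ_eq_zero σ q x).2 hx]
  exact S.one_mem

lemma eq_bot_of_pullback_le {q : ℕ} {S : Subgroup (Kˣ ⧸ powSub K q)}
    (hS : ∀ x ∈ S, jmap q σ x ∈ S) (h : pullback σ q S hS ≤ mulSub (GalUnits σ) (q : ℤ[X])) :
    S = ⊥ := by
  rw [eq_bot_iff]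
  intro y hy
  obtain ⟨x, hx⟩ := toJ_surjective σ q (Additive.ofMul y)
  have h1 : Additive.toMul (toJ σ q x) ∈ S := by rw [hx]; exact hy
  have h2 := (toJ_eq_zero σ q x).2 (h h1)
  rw [hx] at h2
  exact h2

lemma jmap_mem_galSpan (q : ℕ) (S : Set Kˣ) (x : Kˣ ⧸ powSub K q) (hx : x ∈ galSpan q σ S) :
    jmap q σ x ∈ galSpan q σ S := by
  induction hx using Subgroup.closure_induction with
  | mem x hx =>
    obtain ⟨γ, hγ, k, rfl⟩ := hx
    refine Subgroup.subset_closure ⟨γ, hγ, k + 1, ?_⟩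
    rw [pow_succ', umap_mul]
    rfl
  | one => rw [map_one]; exact one_mem _
  | mul x y _ _ hx hy => rw [map_mul]; exact mul_mem hx hy
  | inv x _ hx => rw [map_inv]; exact inv_mem hx

lemma pullback_galSpan {p n m : ℕ} {a : ℕ → WithBot ℕ} {e : ℤ} {α : Kˣ} {δ : ℕ → Kˣ}
    {ξ : GalUnits σ} (h : MinRep p n m a e (gu σ α) (fun i => gu σ (δ i)) ξ) :
    pullback σ (p ^ m) (galSpan (p ^ m) σ (XmSet m α δ)) (jmap_mem_galSpan σ _ _) =
      excSub p m (gu σ α) (fun i => gu σ (δ i)) := by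
  have hcast : ((p ^ m : ℕ) : ℤ[X]) = (p : ℤ[X]) ^ m := Nat.cast_pow _ _
  have hpow : mulSub (GalUnits σ) ((p : ℤ[X]) ^ m) ≤ excSub p m (gu σ α) (fun i => gu σ (δ i)) :=
    le_sup_right
  set M := pullback σ (p ^ m) (galSpan (p ^ m) σ (XmSet m α δ)) (jmap_mem_galSpan σ _ _) with hM
  have hpM : mulSub (GalUnits σ) ((p : ℤ[X]) ^ m) ≤ M := hcast ▸ mulSub_le_pullback σ _
  apply le_antisymm
  · intro x hx
    obtain ⟨z, hz, hzx⟩ : ∃ z ∈ excSub p m (gu σ α) (fun i => gu σ (δ i)),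
        toJ σ (p ^ m) z = Additive.ofMul (Additive.toMul (toJ σ (p ^ m) x)) := by
      refine exists_toJ_eq_of_mem_closure σ ?_ hx
      rintro y ⟨γ, ⟨hγ, -⟩, k, rfl⟩
      refine ⟨(X : ℤ[X]) ^ k • gu σ γ, Submodule.smul_mem _ _ ?_, ?_⟩
      · rcases hγ with rfl | ⟨i, ⟨hi1, hi⟩, rfl⟩
        · exact left_mem_excSub _ _ _ _
        · exact mem_excSub_of_lt p (gu σ α) (fun i => gu σ (δ i)) (by have := h.vec.pos; omega)
      · rw [← gu_umap_pow, toJ_gu]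
    have h1 : x - z ∈ mulSub (GalUnits σ) ((p : ℤ[X]) ^ m) := by
      rw [← hcast, ← toJ_eq_toJ_iff, hzx]
      rfl
    have h2 := add_mem (hpow h1) hz
    rwa [sub_add_cancel] at h2
  · have hγ : ∀ γ ∈ ({α} ∪ δ '' Set.Icc 1 (m - 1) : Set Kˣ), gu σ γ ∈ M := by
      intro γ hγ
      by_cases h1 : γ = 1
      · rw [h1, gu_one]; exact zero_mem _
      · exact Subgroup.subset_closure ⟨γ, ⟨hγ, h1⟩, 0, rfl⟩
    have hα : gu σ α ∈ M := hγ _ (Or.inl rfl)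
    have hδ : ∀ i < m, gu σ (δ i) ∈ M := by
      have hpos : ∀ i, i + 1 < m → gu σ (δ (i + 1)) ∈ M := fun i hi =>
        hγ _ (Or.inr ⟨i + 1, ⟨by omega, by omega⟩, rfl⟩)
      intro i hi
      rcases i with _ | i
      · obtain ⟨l, rfl⟩ : ∃ l, m = l + 1 := ⟨m - 1, by omega⟩
        have h1 := h.eq_smul_sum
        rw [Finset.sum_range_succ', pow_zero, one_smul] at h1
        have h2 : gu σ (δ 0) = ((X : ℤ[X]) - (1 + (p : ℤ[X]) * (e : ℤ[X]))) • gu σ α -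
            ∑ i ∈ Finset.range l, (p : ℤ[X]) ^ (i + 1) • gu σ (δ (i + 1)) -
            (p : ℤ[X]) ^ (l + 1) • gu σ (δ (l + 1)) := by
          rw [h1]; abel
        rw [h2]
        refine sub_mem (sub_mem (M.smul_mem _ hα) (sum_mem fun i hi => M.smul_mem _ (hpos i ?_)))
          (hpM (smul_mem_mulSub _ _))
        have := Finset.mem_range.1 hi
        omega
      · exact hpos i hi
    intro x hx
    obtain ⟨y, κ, rfl⟩ := mem_excSub.1 hx
    exact add_mem (comb_mem hα hδ y) (hpM (smul_mem_mulSub _ _))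

lemma subIndec_galSpan {p n m : ℕ} {a : ℕ → WithBot ℕ} {e : ℤ} {α : Kˣ} {δ : ℕ → Kˣ}
    {ξ : GalUnits σ} (h : MinRep p n m a e (gu σ α) (fun i => gu σ (δ i)) ξ) :
    SubIndec (p ^ m) σ (galSpan (p ^ m) σ (XmSet m α δ)) := by
  have hcast : ((p ^ m : ℕ) : ℤ[X]) = (p : ℤ[X]) ^ m := Nat.cast_pow _ _
  have hpull := pullback_galSpan σ h
  refine ⟨fun hbot => h.not_mem_mulSub ?_, fun S₁ S₂ hle₁ hle₂ hst₁ hst₂ hinf hsup => ?_⟩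
  · have h1 : gu σ α ∈ pullback σ (p ^ m) (galSpan (p ^ m) σ (XmSet m α δ))
        (jmap_mem_galSpan σ _ _) := hpull ▸ left_mem_excSub _ _ _ _
    rw [mem_pullback, hbot] at h1
    rw [← hcast, ← toJ_eq_zero]
    exact h1
  · have hinf' : pullback σ _ S₁ hst₁ ⊓ pullback σ _ S₂ hst₂ =
        mulSub (GalUnits σ) ((p : ℤ[X]) ^ m) := by
      rw [← hcast]
      refine le_antisymm (fun x hx => ?_) (le_inf (mulSub_le_pullback σ _) (mulSub_le_pullback σ _))
      have h1 : Additive.toMul (toJ σ (p ^ m) x) ∈ S₁ ⊓ S₂ := hx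
      rw [hinf] at h1
      exact (toJ_eq_zero σ _ _).1 h1
    have hsup' : pullback σ _ S₁ hst₁ ⊔ pullback σ _ S₂ hst₂ =
        excSub p m (gu σ α) (fun i => gu σ (δ i)) := by
      rw [← hpull]
      refine le_antisymm (sup_le (fun x hx => hle₁ hx) (fun x hx => hle₂ hx)) (fun x hx => ?_)
      rw [mem_pullback, ← hsup, Subgroup.sup_eq_closure] at hx
      obtain ⟨z, hz, hzx⟩ : ∃ z ∈ pullback σ _ S₁ hst₁ ⊔ pullback σ _ S₂ hst₂,
          toJ σ (p ^ m) z = Additive.ofMul (Additive.toMul (toJ σ (p ^ m) x)) := by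
        refine exists_toJ_eq_of_mem_closure σ (fun y hy => ?_) hx
        obtain ⟨z, rfl⟩ := toJ_surjective σ _ y
        exact ⟨z, hy.elim (fun h1 => Submodule.mem_sup_left h1)
          (fun h1 => Submodule.mem_sup_right h1), rfl⟩
      have h1 := Submodule.mem_sup_left (T := pullback σ _ S₂ hst₂)
        (mulSub_le_pullback σ hst₁ ((toJ_eq_toJ_iff σ _ x z).1 hzx.symm))
      have h2 := add_mem h1 hz
      rwa [sub_add_cancel] at h2
    exact (h.indecomposable hinf' hsup').imp (fun h1 => eq_bot_of_pullback_le σ hst₁ (hcast ▸ h1))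
      (fun h1 => eq_bot_of_pullback_le σ hst₂ (hcast ▸ h1))

end Exceptional

section Presentation

open Polynomial

variable {F K : Type*} [Field F] [Field K] [Algebra F K] {σ : K ≃ₐ[F] K}

lemma MinRep.exists_hom_galSpan {p n m : ℕ} {a : ℕ → WithBot ℕ} {e : ℤ} {α : Kˣ} {δ : ℕ → Kˣ}
    {ξ : GalUnits σ} (h : MinRep p n m a e (gu σ α) (fun i => gu σ (δ i)) ξ) :
    ∃ φ : Xadm p n m (fun i : Fin m => a i) (1 + p * e) →+ Additive (Kˣ ⧸ powSub K (p ^ m)),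
      Function.Injective φ ∧
      φ.range = Subgroup.toAddSubgroup (galSpan (p ^ m) σ (XmSet m α δ)) ∧
      (∀ x, φ (gen p m n • x) = Additive.ofMul (jmap (p ^ m) σ (Additive.toMul (φ x)))) ∧
      φ (Submodule.Quotient.mk (sing p n m 0 1)) = Additive.ofMul (jcls (p ^ m) α) ∧
      (∀ i : Fin m, φ (Submodule.Quotient.mk (sing p n m i.succ 1)) =
        Additive.ofMul (jcls (p ^ m) (δ i))) := by
  have hcast : ((p ^ m : ℕ) : ℤ[X]) = (p : ℤ[X]) ^ m := Nat.cast_pow _ _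
  have hp := h.kummer.prime
  obtain ⟨φ, hφ, hval⟩ := h.exists_hom_of_ker (B := Additive (Kˣ ⧸ powSub K (p ^ m)))
      (toJ σ (p ^ m)) fun x => by
    rw [← hcast]
    exact toJ_eq_zero σ _ x
  have hmk : ∀ x : Xadm p n m (fun i : Fin m => a i) (1 + p * e),
      ∃ v, Submodule.Quotient.mk (evalVec p m n v) = x := fun x => by
    obtain ⟨w, rfl⟩ := Submodule.Quotient.mk_surjective _ x
    obtain ⟨v, rfl⟩ := evalVec_surjective hp m n w
    exact ⟨v, rfl⟩
  have hsingle : ∀ j, φ (Submodule.Quotient.mk (sing p n m j 1)) = toJ σ (p ^ m)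
      ((Fin.cons (gu σ α) (fun i : Fin m => gu σ (δ i)) : Fin (m + 1) → GalUnits σ) j) :=
    fun j => by
      rw [← map_one (evalGen p m n), ← evalVec_single, hval, finComb,
        Fintype.linearCombination_apply_single, one_smul]
  refine ⟨φ, hφ, ?_, fun x => ?_, hsingle 0, fun i => hsingle i.succ⟩
  · ext y
    constructor
    · rintro ⟨x, rfl⟩
      obtain ⟨v, rfl⟩ := hmk x
      obtain ⟨g, -, hg⟩ := finComb_eq_comb m (gu σ α) (fun i => gu σ (δ i)) v
      have h1 : finComb m (gu σ α) (fun i => gu σ (δ i)) v ∈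
          excSub p m (gu σ α) (fun i => gu σ (δ i)) :=
        mem_excSub.2 ⟨(v 0, g), 0, by rw [hg, smul_zero, add_zero]⟩
      rw [← pullback_galSpan σ h] at h1
      rw [hval]
      exact h1
    · intro hy
      obtain ⟨x, rfl⟩ := toJ_surjective σ _ y
      have h1 : x ∈ pullback σ _ _ (jmap_mem_galSpan σ (p ^ m) (XmSet m α δ)) := hy
      rw [pullback_galSpan σ h] at h1
      obtain ⟨⟨u, g⟩, κ, hx⟩ := mem_excSub.1 h1
      refine ⟨Submodule.Quotient.mk (evalVec p m n (Fin.cons u fun i => g i)), ?_⟩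
      rw [hval, ← comb_eq_finComb, eq_comm, toJ_eq_toJ_iff, hx, add_sub_cancel_left, hcast]
      exact smul_mem_mulSub _ _
  · obtain ⟨v, rfl⟩ := hmk x
    rw [← Submodule.Quotient.mk_smul, ← evalGen_X, ← evalVec_smul, hval, hval, map_smul,
      toJ_X_smul]

end Presentation

end MSS

/-- **Proposition.**  The `m`-exceptional module
`X = ⟨[α]_m, [δ_1]_m, …, [δ_{m-1}]_m⟩ ⊆ J_m` is isomorphic to `X_{a,d,m}` as an
`R_m[G]`-module, via `y ↦ [α]_m` and `x_i ↦ [δ_i]_m` (`0 ≤ i < m`); moreover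
`X` is indecomposable. -/
theorem statement_18 {F : Type u} {K : Type v} [Field F] [Field K] [Algebra F K]
    [IsGalois F K] [FiniteDimensional F K]
    (p n m : ℕ) (hp : p.Prime) (hn : 0 < n) (hm : 0 < m)
    (σ : K ≃ₐ[F] K) (horder : orderOf σ = p ^ n)
    (hgen : ∀ τ : K ≃ₐ[F] K, τ ∈ Subgroup.zpowers σ)
    (ξ : Kˣ) (hξ : IsPrimitiveRoot (ξ : K) p)
    (hξF : (ξ : K) ∈ Set.range (algebraMap F K))
    (hspecial : p = 2 → n = 1 → ∃ γ : Kˣ, MSS.normHom p σ n γ = -1)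
    (a : Fin m → WithBot ℕ) (d : ℤ) (α : Kˣ) (δ : ℕ → Kˣ)
    (hmin : MSS.IsMinimalNormPair p n σ ξ a d)
    (hrep : MSS.Represents p n σ ξ a d α δ) :
    (∃ φ : MSS.Xadm p n m a d →+ Additive (Kˣ ⧸ MSS.powSub K (p ^ m)),
      Function.Injective φ ∧
      φ.range = Subgroup.toAddSubgroup (MSS.galSpan (p ^ m) σ (MSS.XmSet m α δ)) ∧
      (∀ x : MSS.Xadm p n m a d,
        φ (MSS.gen p m n • x) =
          Additive.ofMul (MSS.jmap (p ^ m) σ (Additive.toMul (φ x)))) ∧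
      φ (Submodule.Quotient.mk (MSS.sing p n m 0 1)) =
        Additive.ofMul (MSS.jcls (p ^ m) α) ∧
      (∀ i : Fin m,
        φ (Submodule.Quotient.mk (MSS.sing p n m i.succ 1)) =
          Additive.ofMul (MSS.jcls (p ^ m) (δ i)))) ∧
    MSS.SubIndec (p ^ m) σ (MSS.galSpan (p ^ m) σ (MSS.XmSet m α δ)) := by
  obtain ⟨b, rfl⟩ : ∃ b : ℕ → WithBot ℕ, (fun i : Fin m => b i) = a :=
    ⟨fun i => if hi : i < m then a ⟨i, hi⟩ else ⊥, funext fun i => by simp⟩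
  obtain ⟨e, rfl⟩ : ∃ e : ℤ, d = 1 + p * e :=
    hmin.1.2.2.1.imp fun e he => by rw [← he, add_sub_cancel]
  have hK := MSS.cyclicKummer σ hp hn horder hξ hξF hspecial
  have h : MSS.MinRep p n m b e (MSS.gu σ α) (fun i => MSS.gu σ (δ i)) (MSS.gu σ ξ) :=
    ⟨hK, MSS.isMinVec σ hm hK hmin, (MSS.represents_iff σ hp.ne_zero ξ b e α δ).1 hrep⟩
  exact ⟨h.exists_hom_galSpan, MSS.subIndec_galSpan σ h⟩
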